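/- Fix integers j ≥ 1 and k ≥ 0. Then there exists N such that for all n ≥ N: (𝒫_{n,k}^{n−j})² ≥ 𝒫_{n,k}^{n−j−1}·𝒫_{n,k}^{n−j+1} and (𝒬_{n,k}^{n−j})² ≥ 𝒬_{n,k}^{n−j−1}·𝒬_{n,k}^{n−j+1}. -/

import Mathlib

open Polynomial

/-- The ring `ℚ[m][t]`: polynomials in `t` with coefficients in `ℚ[m]`. -/
abbrev Qmt : Type := Polynomial (Polynomial ℚ)

/-- The element `m` of `ℚ[m][t]`. -/
noncomputable def mPoly : Qmt := Polynomial.C Polynomial.X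

/-- `f^{[d]}`: substitute `t ↦ t^d`, leaving `m` unchanged. -/
noncomputable def tPow (d : ℕ) (f : Qmt) : Qmt := f.comp (Polynomial.X ^ d)

/-- `f^{[μ]} = f^{[μ₁]} ⋯ f^{[μ_ℓ]}` for a multiset `μ` of positive integers. -/
noncomputable def tPowMul (μ : Multiset ℕ) (f : Qmt) : Qmt := (μ.map (fun d => tPow d f)).prod

/-- `z_μ = ∏ i, i ^ (mult of i) * (mult of i)!`. -/
def zPart (μ : Multiset ℕ) : ℕ := ∏ i ∈ μ.toFinset, i ^ μ.count i * (μ.count i).factorial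

/-- The plethysm `h_r ∘ f = Σ_{μ ⊢ r} z_μ⁻¹ f^{[μ]}`. -/
noncomputable def plethH (r : ℕ) (f : Qmt) : Qmt :=
  ∑ μ : Nat.Partition r, Polynomial.C (Polynomial.C ((zPart μ.parts : ℚ)⁻¹)) * tPowMul μ.parts f

/-- The polynomials `𝒬ₙ⁺ ∈ ℚ[m][t]`: `𝒬₁⁺ = m` and, for `n ≥ 2`,
`𝒬ₙ⁺ = Σ_{λ ⊢ n} (Σ_{i=1}^{ℓ(λ)-2} t^i) ∏_j (h_{r_j} ∘ 𝒬⁺_{n_j})` where `n_j` are the distinct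
parts of `λ` with multiplicities `r_j`.  (The recursion is well-founded: the term of `λ = (n)`
has coefficient `Σ_{i=1}^{1-2} t^i = 0`, so the guard `p < n` does not change any value.) -/
noncomputable def Qplus : ℕ → Qmt := fun n =>
  Nat.strongRecOn n fun n ih =>
    if n = 1 then mPoly
    else
      ∑ lam : Nat.Partition n,
        (∑ i ∈ Finset.Icc 1 (Multiset.card lam.parts - 2), (Polynomial.X : Qmt) ^ i) *
          ∏ p ∈ lam.parts.toFinset,
            plethH (lam.parts.count p) (if h : p < n then ih p h else 0)

/-- The polynomials `𝒬ₙ ∈ ℚ[m][t]`: `𝒬₁ = m` and, for `n ≥ 2`,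
`𝒬ₙ = Σ_{λ ⊢ n} ∏_j (h_{r_j} ∘ 𝒬⁺_{n_j})`. -/
noncomputable def Qfull (n : ℕ) : Qmt :=
  if n = 1 then mPoly
  else ∑ lam : Nat.Partition n, ∏ p ∈ lam.parts.toFinset, plethH (lam.parts.count p) (Qplus p)

/-- `𝒬_{n,k}(m)`: the coefficient of `t^k` in `𝒬ₙ`, a polynomial in `m`. -/
noncomputable def Qnk (n k : ℕ) : Polynomial ℚ := (Qfull n).coeff k

/-- The right-hand side `𝒬ₙ − (t/2)(Σ_{h=2}^{n-2} 𝒬_h 𝒬_{n-h} − 𝒬_{n/2}^{[2]})` of the relation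
defining `𝒫ₙ`, where `𝒬_{n/2} = 0` when `n` is odd. -/
noncomputable def Prhs (n : ℕ) : Qmt :=
  Qfull n -
    Polynomial.C (Polynomial.C ((2 : ℚ)⁻¹)) * Polynomial.X *
      ((∑ h ∈ Finset.Icc 2 (n - 2), Qfull h * Qfull (n - h)) -
        (if 2 ∣ n then tPow 2 (Qfull (n / 2)) else 0))

/-- `c_k = (k+1)^{k-1}/k!`. -/
noncomputable def ck (k : ℕ) : ℚ := ((k : ℚ) + 1) ^ ((k : ℤ) - 1) / (k.factorial : ℚ)

/-- `d_k = (k+1)^{k-2}/k!`. -/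
noncomputable def dk (k : ℕ) : ℚ := ((k : ℚ) + 1) ^ ((k : ℤ) - 2) / (k.factorial : ℚ)

section PartitionSums

variable {R : Type*} [CommRing R]

/-- The weight `∏_p g p c_p` of a multiset in which `p` occurs `c_p` times. -/
def multWeight (g : ℕ → ℕ → R) (μ : Multiset ℕ) : R := ∏ p ∈ μ.toFinset, g p (μ.count p)

/-- The sum of the weights of the partitions of `n`. -/
def partSum (g : ℕ → ℕ → R) (n : ℕ) : R := ∑ lam : Nat.Partition n, multWeight g lam.parts

lemma multWeight_eq_prod {g : ℕ → ℕ → R} (h0 : ∀ p, g p 0 = 1) {μ : Multiset ℕ} {s : Finset ℕ}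
    (hs : μ.toFinset ⊆ s) : multWeight g μ = ∏ p ∈ s, g p (μ.count p) := by
  refine Finset.prod_subset hs fun p _ hp => ?_
  rw [Multiset.count_eq_zero.2 (by simpa using hp), h0]

lemma sum_partition_sub_replicate (F : Multiset ℕ → R) {n p i : ℕ} (hp : 1 ≤ p) :
    (∑ lam : Nat.Partition n,
      if i ≤ lam.parts.count p then F (lam.parts - Multiset.replicate i p) else 0) =
    if p * i ≤ n then ∑ lam : Nat.Partition (n - p * i), F lam.parts else 0 := by
  classical
  have key : ∀ lam : Nat.Partition n, i ≤ lam.parts.count p →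
      (lam.parts - Multiset.replicate i p).sum + p * i = n := by
    intro lam h
    have h1 := Multiset.sub_add_cancel (Multiset.le_count_iff_replicate_le.1 h)
    have h2 := congrArg Multiset.sum h1
    rw [Multiset.sum_add, lam.parts_sum, Multiset.sum_replicate, smul_eq_mul] at h2
    rw [mul_comm p i, h2]
  rw [← Finset.sum_filter]
  split_ifs with hn
  · refine Finset.sum_bij'
      (fun lam h => ⟨lam.parts - Multiset.replicate i p,
        fun {q} hq => lam.parts_pos (Multiset.mem_of_le (Multiset.sub_le_self _ _) hq), by
          have := key lam (by simpa using h); omega⟩)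
      (fun lam _ => ⟨lam.parts + Multiset.replicate i p, fun {q} hq => by
          rcases Multiset.mem_add.1 hq with hq | hq
          · exact lam.parts_pos hq
          · rw [Multiset.eq_of_mem_replicate hq]; exact hp, by
          rw [Multiset.sum_add, lam.parts_sum, Multiset.sum_replicate, smul_eq_mul, mul_comm i p]
          omega⟩) ?_ ?_ ?_ ?_ ?_
    · simp
    · intro lam _; simp
    · intro lam h
      ext1
      exact Multiset.sub_add_cancel (Multiset.le_count_iff_replicate_le.1 (by simpa using h))
    · intro lam _
      ext1
      simp
    · simp
  · refine Finset.sum_eq_zero fun lam h => ?_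
    have := key lam (by simpa using h)
    omega

/-- If for each `p` the series `∑ g p c y^c` has logarithmic derivative `∑ k p i y^i` (with respect
to `y d/dy`), then the generating series of `partSum g` has logarithmic derivative
`∑ p * k p i * x^(p * i)` (with respect to `x d/dx`). -/
lemma natCast_mul_partSum {g k : ℕ → ℕ → R} (h0 : ∀ p, g p 0 = 1)
    (hg : ∀ p, 1 ≤ p → ∀ c : ℕ, (c : R) * g p c = ∑ i ∈ Finset.Icc 1 c, k p i * g p (c - i)) (n : ℕ) :
    (n : R) * partSum g n = ∑ a ∈ Finset.HasAntidiagonal.antidiagonal n,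
      (∑ d ∈ a.1.divisorsAntidiagonal, (d.1 : R) * k d.1 d.2) * partSum g a.2 := by
  classical
  have h1 : ∀ lam : Nat.Partition n, (n : R) * multWeight g lam.parts =
      ∑ p ∈ Finset.Icc 1 n, ∑ i ∈ Finset.Icc 1 n, (p : R) * k p i *
        if i ≤ lam.parts.count p then multWeight g (lam.parts - Multiset.replicate i p) else 0 := by
    intro lam
    have hsub : lam.parts.toFinset ⊆ Finset.Icc 1 n := fun q hq => by
      rw [Multiset.mem_toFinset] at hq
      exact Finset.mem_Icc.2 ⟨lam.parts_pos hq, by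
        have := Multiset.le_sum_of_mem hq
        rwa [lam.parts_sum] at this⟩
    have hn : n = ∑ p ∈ Finset.Icc 1 n, lam.parts.count p * p := by
      conv_lhs => rw [← lam.parts_sum, Finset.sum_multiset_count_of_subset _ _ hsub]
      simp
    have hcast : (n : R) = ∑ p ∈ Finset.Icc 1 n, (lam.parts.count p : R) * p := by
      conv_lhs => rw [hn]
      push_cast; rfl
    rw [hcast, Finset.sum_mul]
    refine Finset.sum_congr rfl fun p hp => ?_
    have hp1 := (Finset.mem_Icc.1 hp).1
    have hcn : lam.parts.count p ≤ n := by
      calc lam.parts.count p ≤ lam.parts.count p * p := Nat.le_mul_of_pos_right _ hp1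
        _ ≤ ∑ p ∈ Finset.Icc 1 n, lam.parts.count p * p :=
          Finset.single_le_sum (f := fun p => lam.parts.count p * p) (fun _ _ => Nat.zero_le _) hp
        _ = n := hn.symm
    set c := lam.parts.count p with hc
    have hE := multWeight_eq_prod h0 hsub
    rw [← Finset.mul_prod_erase _ _ hp, ← hc] at hE
    set W := ∏ q ∈ (Finset.Icc 1 n).erase p, g q (lam.parts.count q) with hW
    have h2 : ∀ i, multWeight g (lam.parts - Multiset.replicate i p) = g p (c - i) * W := by
      intro i
      rw [multWeight_eq_prod h0 (s := Finset.Icc 1 n)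
        (fun q hq => hsub (by
          rw [Multiset.mem_toFinset] at hq ⊢
          exact Multiset.mem_of_le (Multiset.sub_le_self _ _) hq)),
        ← Finset.mul_prod_erase _ _ hp]
      congr 1
      · simp [hc]
      · refine Finset.prod_congr rfl fun q hq => ?_
        rw [Multiset.count_sub, Multiset.count_replicate,
          if_neg (Finset.ne_of_mem_erase hq).symm, Nat.sub_zero]
    simp_rw [h2, hE, mul_ite, mul_zero]
    rw [← Finset.sum_filter, show (Finset.Icc 1 n).filter (fun i => i ≤ c) = Finset.Icc 1 c by
      ext i; simp; omega]
    calc (c : R) * p * (g p c * W) = p * W * (c * g p c) := by ring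
      _ = _ := by
        rw [hg p hp1 c, Finset.mul_sum]
        exact Finset.sum_congr rfl fun i _ => by ring
  have h3 : (n : R) * partSum g n = ∑ p ∈ Finset.Icc 1 n, ∑ i ∈ Finset.Icc 1 n,
      if p * i ≤ n then (p : R) * k p i * partSum g (n - p * i) else 0 := by
    rw [partSum, Finset.mul_sum, Finset.sum_congr rfl fun lam _ => h1 lam, Finset.sum_comm]
    refine Finset.sum_congr rfl fun p hp => ?_
    rw [Finset.sum_comm]
    refine Finset.sum_congr rfl fun i _ => ?_
    rw [← Finset.mul_sum, sum_partition_sub_replicate _ (Finset.mem_Icc.1 hp).1, mul_ite, mul_zero]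
    rfl
  rw [h3, ← Finset.sum_product', ← Finset.sum_filter, Finset.Nat.sum_antidiagonal_eq_sum_range_succ
    (fun a b => (∑ d ∈ a.divisorsAntidiagonal, (d.1 : R) * k d.1 d.2) * partSum g b)]
  simp_rw [Finset.sum_mul]
  rw [Finset.sum_sigma']
  refine Finset.sum_bij' (fun x _ => ⟨x.1 * x.2, x⟩) (fun y _ => y.2) ?_ ?_ ?_ ?_ ?_
  · rintro ⟨p, i⟩ h
    simp at h ⊢
    refine ⟨by omega, by omega, by omega⟩
  · rintro ⟨a, p, i⟩ h
    simp at h ⊢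
    obtain ⟨h1, h2, h3⟩ := h
    subst h2
    have hp : p ≠ 0 := by rintro rfl; simp at h3
    have hi : i ≠ 0 := by rintro rfl; simp at h3
    have := Nat.le_mul_of_pos_right p (Nat.pos_of_ne_zero hi)
    have := Nat.le_mul_of_pos_left i (Nat.pos_of_ne_zero hp)
    omega
  · rintro ⟨p, i⟩ h; rfl
  · rintro ⟨a, p, i⟩ h
    simp at h
    obtain ⟨h1, h2, h3⟩ := h
    subst h2
    rfl
  · rintro ⟨p, i⟩ h; rfl

end PartitionSums

section Plethysm

open Finset.HasAntidiagonal (antidiagonal)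

lemma partSum_zero {R : Type*} [CommRing R] (g : ℕ → ℕ → R) : partSum g 0 = 1 := by
  have : (default : Nat.Partition 0).parts = 0 := by simp
  rw [partSum, Fintype.sum_unique, multWeight, this]
  simp

/-- The weights defining `h_r ∘ f` as a sum over partitions of `r`. -/
noncomputable def plethWeight (f : Qmt) (d c : ℕ) : Qmt :=
  C (C (((d ^ c * c.factorial : ℕ) : ℚ)⁻¹)) * tPow d f ^ c

lemma plethH_eq_partSum (r : ℕ) (f : Qmt) : plethH r f = partSum (plethWeight f) r := by
  refine Finset.sum_congr rfl fun μ _ => ?_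
  rw [multWeight]
  simp only [plethWeight]
  rw [Finset.prod_mul_distrib, tPowMul, Finset.prod_multiset_map_count, zPart]
  simp only [← map_prod, Nat.cast_prod, Finset.prod_inv_distrib]

lemma plethH_zero (f : Qmt) : plethH 0 f = 1 := by rw [plethH_eq_partSum, partSum_zero]

lemma natCast_mul_plethH (r : ℕ) (f : Qmt) :
    (r : Qmt) * plethH r f = ∑ i ∈ Finset.Icc 1 r, tPow i f * plethH (r - i) f := by
  have hC : ∀ d : ℕ, 1 ≤ d → (d : Qmt) * C (C ((d : ℚ)⁻¹)) = 1 := fun d hd => by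
    have : (d : Qmt) = C (C (d : ℚ)) := by simp
    rw [this, ← C_mul, ← C_mul, mul_inv_cancel₀ (by positivity), C_1, C_1]
  have h := natCast_mul_partSum (g := plethWeight f)
    (k := fun d i => if i = 1 then C (C ((d : ℚ)⁻¹)) * tPow d f else 0)
    (fun p => by simp [plethWeight]) (fun p hp c => ?_) r
  · simp only [plethH_eq_partSum]
    rw [h, Finset.Nat.sum_antidiagonal_eq_sum_range_succ
      (fun a b => (∑ d ∈ a.divisorsAntidiagonal, (d.1 : Qmt) *
        if d.2 = 1 then C (C ((d.1 : ℚ)⁻¹)) * tPow d.1 f else 0) * partSum (plethWeight f) b),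
      Finset.sum_range_succ', Finset.range_eq_Ico, Finset.sum_Ico_add'
      (fun a => (∑ d ∈ a.divisorsAntidiagonal, (d.1 : Qmt) *
        if d.2 = 1 then C (C ((d.1 : ℚ)⁻¹)) * tPow d.1 f else 0) *
          partSum (plethWeight f) (r - a))]
    simp only [Nat.divisorsAntidiagonal_zero, Finset.sum_empty, zero_mul, add_zero, zero_add]
    refine Finset.sum_congr (by ext; simp) fun a ha => ?_
    have ha1 : 1 ≤ a := by simp at ha; omega
    congr 1
    rw [Finset.sum_eq_single (a, 1)]
    · rw [if_pos rfl, ← mul_assoc, hC a ha1, one_mul]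
    · rintro ⟨p, i⟩ hd hne
      rw [if_neg, mul_zero]
      rintro rfl
      simp at hd hne
      omega
    · intro h
      simp at h
      omega
  · rcases c with - | c
    · simp
    · rw [Finset.sum_eq_single 1]
      · simp only [if_true, plethWeight, Nat.add_sub_cancel]
        have e : C (C (((p ^ (c + 1) * (c + 1).factorial : ℕ) : ℚ)⁻¹)) * ((c + 1 : ℕ) : Qmt) =
            C (C ((p : ℚ)⁻¹)) * C (C (((p ^ c * c.factorial : ℕ) : ℚ)⁻¹)) := by
          have : ((c + 1 : ℕ) : Qmt) = C (C ((c + 1 : ℕ) : ℚ)) := by simp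
          rw [this, ← C_mul, ← C_mul, ← C_mul, ← C_mul]
          congr 2
          have : (p : ℚ) ≠ 0 := by positivity
          rw [Nat.factorial_succ]
          push_cast
          field_simp
          ring
        calc _ = (C (C (((p ^ (c + 1) * (c + 1).factorial : ℕ) : ℚ)⁻¹)) * ((c + 1 : ℕ) : Qmt)) *
              tPow p f ^ (c + 1) := by ring
          _ = _ := by rw [e]; ring
      · intro i _ hi; simp [hi]
      · simp

/-- The weights `w^c (h_c ∘ 𝒬_p^+)`. -/
noncomputable def expWeight (w : Qmt) (p c : ℕ) : Qmt := w ^ c * plethH c (Qplus p)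

/-- The coefficients of the plethystic exponential of `w ∑ 𝒬_n^+ x^n`. -/
noncomputable def plethExp (w : Qmt) (n : ℕ) : Qmt := partSum (expWeight w) n

/-- The coefficients of the logarithm of the plethystic exponential of `w ∑ 𝒬_n^+ x^n`. -/
noncomputable def plethLog (w : Qmt) (n : ℕ) : Qmt :=
  ∑ d ∈ n.divisorsAntidiagonal, C (C ((d.2 : ℚ)⁻¹)) * (w ^ d.2 * tPow d.2 (Qplus d.1))

lemma natCast_mul_plethExp (w : Qmt) (n : ℕ) : (n : Qmt) * plethExp w n =
    ∑ a ∈ antidiagonal n, ((a.1 : Qmt) * plethLog w a.1) * plethExp w a.2 := by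
  have hC : ∀ d : ℕ, d ≠ 0 → (d : Qmt) * C (C ((d : ℚ)⁻¹)) = 1 := fun d hd => by
    have : (d : Qmt) = C (C (d : ℚ)) := by simp
    rw [this, ← C_mul, ← C_mul, mul_inv_cancel₀ (by positivity), C_1, C_1]
  rw [plethExp, natCast_mul_partSum (k := fun p i => w ^ i * tPow i (Qplus p))
    (fun p => by simp [expWeight, plethH_zero]) (fun p hp c => ?_)]
  · refine Finset.sum_congr rfl fun a _ => ?_
    congr 1
    rw [plethLog, Finset.mul_sum]
    refine Finset.sum_congr rfl fun d hd => ?_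
    rw [Nat.mem_divisorsAntidiagonal] at hd
    have : (a.1 : Qmt) = d.1 * d.2 := by rw [← hd.1]; push_cast; rfl
    rw [this]
    linear_combination (-(d.1 : Qmt) * (w ^ d.2 * tPow d.2 (Qplus d.1))) *
      hC d.2 (by rintro h; simp [h] at hd; omega)
  · simp only [expWeight]
    rw [mul_left_comm, natCast_mul_plethH, Finset.mul_sum]
    refine Finset.sum_congr rfl fun i hi => ?_
    have : w ^ c = w ^ i * w ^ (c - i) := by
      rw [← pow_add, Nat.add_sub_cancel' (Finset.mem_Icc.1 hi).2]
    rw [this]; ring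

lemma plethExp_zero (w : Qmt) : plethExp w 0 = 1 := partSum_zero _

lemma plethH_one (f : Qmt) : plethH 1 f = f := by
  have h := natCast_mul_plethH 1 f
  simpa [plethH_zero, tPow] using h

lemma Qplus_one : Qplus 1 = mPoly := by
  rw [Qplus, Nat.strongRecOn_eq]; simp

lemma Qplus_eq {n : ℕ} (hn : n ≠ 1) : Qplus n = ∑ lam : Nat.Partition n,
    (∑ i ∈ Finset.Icc 1 (Multiset.card lam.parts - 2), (X : Qmt) ^ i) *
      ∏ p ∈ lam.parts.toFinset, plethH (lam.parts.count p) (if p < n then Qplus p else 0) := by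
  conv_lhs => rw [Qplus, Nat.strongRecOn_eq]
  rw [if_neg hn]
  rfl

lemma plethExp_one (w : Qmt) : plethExp w 1 = w * mPoly := by
  have h := natCast_mul_plethExp w 1
  simpa [Finset.Nat.antidiagonal_succ, plethExp_zero, plethLog, Qplus_one, tPow] using h

lemma Qfull_eq_plethExp (n : ℕ) : Qfull n = plethExp 1 n := by
  rw [Qfull]
  split_ifs with h
  · rw [h, plethExp_one, one_mul]
  · refine Finset.sum_congr rfl fun lam _ => ?_
    simp [multWeight, expWeight]

lemma multWeight_expWeight (w : Qmt) (μ : Multiset ℕ) :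
    multWeight (expWeight w) μ = w ^ Multiset.card μ * multWeight (expWeight 1) μ := by
  simp only [multWeight, expWeight, one_pow, one_mul]
  rw [Finset.prod_mul_distrib, Finset.prod_pow_eq_pow_sum, Multiset.toFinset_sum_count_eq]

lemma lt_of_mem_of_two_le_card {n p : ℕ} (lam : Nat.Partition n) (h : 2 ≤ Multiset.card lam.parts)
    (hp : p ∈ lam.parts) : p < n := by
  obtain ⟨t, ht⟩ := Multiset.exists_cons_of_mem hp
  have hs := lam.parts_sum
  rw [ht, Multiset.sum_cons] at hs
  have hc : 0 < Multiset.card t := by rw [ht, Multiset.card_cons] at h; omega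
  obtain ⟨q, hq⟩ := Multiset.card_pos_iff_exists_mem.1 hc
  have hq1 : 0 < q := lam.parts_pos (by rw [ht]; exact Multiset.mem_cons_of_mem hq)
  have := Multiset.le_sum_of_mem hq
  omega

lemma mul_sum_Icc_pow {l : ℕ} (hl : 2 ≤ l) :
    (X ^ 2 - X : Qmt) * ∑ i ∈ Finset.Icc 1 (l - 2), (X : Qmt) ^ i = X ^ l - X ^ 2 := by
  obtain ⟨l, rfl⟩ := Nat.exists_eq_add_of_le hl
  rw [Nat.add_sub_cancel_left]
  induction l with
  | zero => simp
  | succ l ih =>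
    rw [Finset.sum_Icc_succ_top (by omega), mul_add, ih (by omega)]
    ring

lemma plethExp_X {n : ℕ} (hn : 2 ≤ n) : plethExp X n = X ^ 2 * plethExp 1 n := by
  classical
  have hterm : ∀ lam : Nat.Partition n,
      (X ^ 2 - X : Qmt) * ((∑ i ∈ Finset.Icc 1 (Multiset.card lam.parts - 2), (X : Qmt) ^ i) *
        ∏ p ∈ lam.parts.toFinset, plethH (lam.parts.count p) (if p < n then Qplus p else 0)) =
      multWeight (expWeight X) lam.parts - X ^ 2 * multWeight (expWeight 1) lam.parts +
        if lam = Nat.Partition.indiscrete n then (X ^ 2 - X) * Qplus n else 0 := by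
    intro lam
    rw [multWeight_expWeight X]
    by_cases h : 2 ≤ Multiset.card lam.parts
    · rw [if_neg, ← mul_assoc, mul_sum_Icc_pow h]
      · have : ∏ p ∈ lam.parts.toFinset,
            plethH (lam.parts.count p) (if p < n then Qplus p else 0) =
            multWeight (expWeight 1) lam.parts := by
          refine Finset.prod_congr rfl fun p hp => ?_
          rw [if_pos (lt_of_mem_of_two_le_card lam h (Multiset.mem_toFinset.1 hp)), expWeight,
            one_pow, one_mul]
        rw [this]; ring
      · rintro rfl
        rw [Nat.Partition.indiscrete_parts (by omega)] at h
        simp at h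
    · have hparts : lam.parts = {n} := by
        have hs := lam.parts_sum
        obtain h0 | h1 : Multiset.card lam.parts = 0 ∨ Multiset.card lam.parts = 1 := by omega
        · rw [Multiset.card_eq_zero] at h0
          rw [h0] at hs; simp at hs; omega
        · obtain ⟨a, ha⟩ := Multiset.card_eq_one.1 h1
          rw [ha] at hs ⊢
          simpa using hs
      rw [if_pos (by ext1; rw [hparts, Nat.Partition.indiscrete_parts (by omega)]), hparts]
      simp [multWeight, expWeight, plethH_one]
      ring
  have hsum := congrArg (fun f => (X ^ 2 - X : Qmt) * f) (Qplus_eq (n := n) (by omega))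
  simp only [Finset.mul_sum _ _ (X ^ 2 - X : Qmt), hterm] at hsum
  rw [Finset.sum_add_distrib, Finset.sum_sub_distrib, ← Finset.mul_sum, Finset.sum_ite_eq',
    if_pos (Finset.mem_univ _)] at hsum
  change _ = plethExp X n - X ^ 2 * plethExp 1 n + _ at hsum
  linear_combination -hsum

end Plethysm

section MDegree

open Finset.HasAntidiagonal (antidiagonal)

/-- The elements of `ℚ[m][t]` of degree at most `N` in `m`. -/
def mDegLE (N : ℕ) : AddSubgroup Qmt where
  carrier := {f | ∀ k, (f.coeff k).natDegree ≤ N}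
  zero_mem' := by simp
  add_mem' := fun {f g} hf hg k => by
    rw [coeff_add]; exact natDegree_add_le_of_degree_le (hf k) (hg k)
  neg_mem' := fun {f} hf k => by rw [coeff_neg, natDegree_neg]; exact hf k

lemma mDegLE_mono {M N : ℕ} (h : M ≤ N) {f : Qmt} (hf : f ∈ mDegLE M) : f ∈ mDegLE N :=
  fun k => (hf k).trans h

lemma mul_mem_mDegLE {M N : ℕ} {f g : Qmt} (hf : f ∈ mDegLE M) (hg : g ∈ mDegLE N) :
    f * g ∈ mDegLE (M + N) := fun k => by
  rw [coeff_mul]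
  exact natDegree_sum_le_of_forall_le _ _ fun a _ => natDegree_mul_le_of_le (hf _) (hg _)

lemma C_C_mem_mDegLE (q : ℚ) (N : ℕ) : (C (C q) : Qmt) ∈ mDegLE N := fun k => by
  rw [coeff_C]; split_ifs <;> simp

lemma one_mem_mDegLE (N : ℕ) : (1 : Qmt) ∈ mDegLE N := by
  simpa using C_C_mem_mDegLE 1 N

lemma X_mem_mDegLE (N : ℕ) : (X : Qmt) ∈ mDegLE N := fun k => by
  rw [coeff_X]; split_ifs <;> simp

lemma mPoly_mem_mDegLE : mPoly ∈ mDegLE 1 := fun k => by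
  rw [mPoly, coeff_C]; split_ifs <;> simp

lemma pow_mem_mDegLE {N : ℕ} {f : Qmt} (hf : f ∈ mDegLE N) (r : ℕ) : f ^ r ∈ mDegLE (r * N) := by
  induction r with
  | zero => simpa using one_mem_mDegLE 0
  | succ r ih => rw [pow_succ, add_mul, one_mul]; exact mul_mem_mDegLE ih hf

lemma prod_mem_mDegLE {ι : Type*} (s : Finset ι) (f : ι → Qmt) (N : ι → ℕ)
    (h : ∀ i ∈ s, f i ∈ mDegLE (N i)) : ∏ i ∈ s, f i ∈ mDegLE (∑ i ∈ s, N i) := by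
  classical
  induction s using Finset.induction_on with
  | empty => simpa using one_mem_mDegLE 0
  | insert a s ha ih =>
    rw [Finset.prod_insert ha, Finset.sum_insert ha]
    exact mul_mem_mDegLE (h a (by simp)) (ih fun i hi => h i (by simp [hi]))

lemma coeff_tPow {d : ℕ} (hd : 0 < d) (f : Qmt) (k : ℕ) :
    (tPow d f).coeff k = if d ∣ k then f.coeff (k / d) else 0 := by
  rw [tPow, ← expand_eq_comp_X_pow, coeff_expand hd]

lemma tPow_mem_mDegLE {N d : ℕ} (hd : 0 < d) {f : Qmt} (hf : f ∈ mDegLE N) :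
    tPow d f ∈ mDegLE N := fun k => by
  rw [coeff_tPow hd]
  split_ifs
  · exact hf _
  · simp

lemma multWeight_mem_mDegLE {g : ℕ → ℕ → Qmt} {N n : ℕ} (lam : Nat.Partition n)
    (hg : ∀ p ∈ lam.parts, ∀ c, g p c ∈ mDegLE (c * p * N)) :
    multWeight g lam.parts ∈ mDegLE (n * N) := by
  have h : n = ∑ p ∈ lam.parts.toFinset, lam.parts.count p * p := by
    conv_lhs => rw [← lam.parts_sum, Finset.sum_multiset_count]
    simp
  conv in n * N => rw [h, Finset.sum_mul]
  exact prod_mem_mDegLE _ _ _ fun p hp => hg p (Multiset.mem_toFinset.1 hp) _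

lemma plethH_mem_mDegLE {N : ℕ} {f : Qmt} (hf : f ∈ mDegLE N) (r : ℕ) :
    plethH r f ∈ mDegLE (r * N) := by
  rw [plethH_eq_partSum]
  refine sum_mem fun lam _ => multWeight_mem_mDegLE lam fun p hp c => ?_
  have hp1 := lam.parts_pos hp
  rw [plethWeight, ← zero_add (c * p * N), mul_assoc]
  exact mul_mem_mDegLE (C_C_mem_mDegLE _ _) (pow_mem_mDegLE
    (mDegLE_mono (Nat.le_mul_of_pos_left _ hp1) (tPow_mem_mDegLE hp1 hf)) c)

lemma Qplus_mem_mDegLE (n : ℕ) : Qplus n ∈ mDegLE n := by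
  induction n using Nat.strong_induction_on with
  | _ n ih =>
    by_cases hn : n = 1
    · subst hn; rw [Qplus_one]; exact mPoly_mem_mDegLE
    · rw [Qplus_eq hn]
      refine sum_mem fun lam _ => ?_
      suffices h : _ ∈ mDegLE (0 + n) by rwa [zero_add] at h
      refine mul_mem_mDegLE (sum_mem fun i _ => by
        simpa using pow_mem_mDegLE (X_mem_mDegLE 0) i) ?_
      have := multWeight_mem_mDegLE (N := 1)
        (g := fun p c => plethH c (if p < n then Qplus p else 0)) lam fun p _ c => ?_
      · simpa [multWeight] using this
      · rw [mul_one]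
        refine plethH_mem_mDegLE ?_ c
        split_ifs with h
        · exact ih p h
        · exact zero_mem _

lemma plethExp_mem_mDegLE {w : Qmt} (hw : w ∈ mDegLE 0) (n : ℕ) : plethExp w n ∈ mDegLE n := by
  rw [plethExp, partSum]
  refine sum_mem fun lam _ => ?_
  have := multWeight_mem_mDegLE (g := expWeight w) (N := 1) lam fun p _ c => by
    have := mul_mem_mDegLE (pow_mem_mDegLE hw c) (plethH_mem_mDegLE (Qplus_mem_mDegLE p) c)
    rwa [mul_zero, zero_add, ← mul_one (c * p)] at this
  rwa [mul_one] at this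

lemma plethLog_term_mem_mDegLE {w : Qmt} (hw : w ∈ mDegLE 0) {n : ℕ} {d : ℕ × ℕ}
    (hd : d ∈ n.divisorsAntidiagonal) :
    C (C ((d.2 : ℚ)⁻¹)) * (w ^ d.2 * tPow d.2 (Qplus d.1)) ∈ mDegLE d.1 := by
  have h2 : 0 < d.2 := by
    rw [Nat.mem_divisorsAntidiagonal] at hd
    rcases Nat.eq_zero_or_pos d.2 with h | h
    · simp [h] at hd; omega
    · exact h
  have := mul_mem_mDegLE (C_C_mem_mDegLE (d.2 : ℚ)⁻¹ 0) (mul_mem_mDegLE (pow_mem_mDegLE hw d.2)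
    (tPow_mem_mDegLE h2 (Qplus_mem_mDegLE d.1)))
  simpa using this

lemma plethLog_mem_mDegLE {w : Qmt} (hw : w ∈ mDegLE 0) (n : ℕ) : plethLog w n ∈ mDegLE n :=
  sum_mem fun d hd => mDegLE_mono (by
    rw [Nat.mem_divisorsAntidiagonal] at hd
    exact Nat.le_of_dvd (by omega) ⟨d.2, hd.1.symm⟩) (plethLog_term_mem_mDegLE hw hd)

lemma plethLog_zero (w : Qmt) : plethLog w 0 = 0 := by simp [plethLog]

lemma plethLog_sub_mem_mDegLE {w : Qmt} (hw : w ∈ mDegLE 0) {n : ℕ} (hn : n ≠ 0) :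
    plethLog w n - w * Qplus n ∈ mDegLE (n / 2) := by
  have hmem : (n, 1) ∈ n.divisorsAntidiagonal := by simp [hn]
  rw [plethLog, ← Finset.add_sum_erase _ _ hmem]
  have : C (C (((1 : ℕ) : ℚ)⁻¹)) * (w ^ 1 * tPow 1 (Qplus n)) = w * Qplus n := by simp [tPow]
  rw [this, add_sub_cancel_left]
  refine sum_mem fun d hd => ?_
  rw [Finset.mem_erase] at hd
  refine mDegLE_mono ?_ (plethLog_term_mem_mDegLE hw hd.2)
  obtain ⟨p, i⟩ := d
  simp only [Nat.mem_divisorsAntidiagonal, ne_eq, Prod.mk.injEq] at hd ⊢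
  obtain ⟨h1, h2, h3⟩ := hd
  rw [Nat.le_div_iff_mul_le two_pos]
  have : 2 ≤ i := by
    rcases i with - | - | i
    · omega
    · simp at h1 h2; omega
    · omega
  rw [← h2]
  exact Nat.mul_le_mul_left _ this

lemma Qplus_coeff_zero {n : ℕ} (hn : n ≠ 1) : (Qplus n).coeff 0 = 0 := by
  rw [Qplus_eq hn, finsetSum_coeff]
  refine Finset.sum_eq_zero fun lam _ => ?_
  rw [mul_coeff_zero, finsetSum_coeff, Finset.sum_eq_zero, zero_mul]
  intro i hi
  rw [coeff_X_pow, if_neg]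
  simp at hi; omega

lemma plethLog_one_coeff_zero {n : ℕ} (hn : n ≠ 0) :
    (n : ℚ[X]) * (plethLog 1 n).coeff 0 = X := by
  rw [plethLog, finsetSum_coeff, Finset.sum_eq_single (1, n)]
  · have hC : (n : ℚ[X]) * C ((n : ℚ)⁻¹) = 1 := by
      rw [← C_eq_natCast, ← C_mul, mul_inv_cancel₀ (by positivity), C_1]
    rw [coeff_C_mul, one_pow, one_mul, coeff_tPow (by omega), Qplus_one, mPoly]
    simp only [dvd_zero, if_true, Nat.zero_div, coeff_C_zero]
    rw [← mul_assoc, hC, one_mul]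
  · rintro ⟨p, i⟩ hd hne
    simp only [Nat.mem_divisorsAntidiagonal, ne_eq, Prod.mk.injEq] at hd hne
    have hi : 0 < i := by
      rcases Nat.eq_zero_or_pos i with h | h
      · simp [h] at hd; omega
      · exact h
    rw [coeff_C_mul, one_pow, one_mul, coeff_tPow hi, if_pos (dvd_zero _), Nat.zero_div,
      Qplus_coeff_zero, mul_zero]
    rintro rfl
    simp at hd hne; omega
  · simp [hn]

lemma plethExp_one_coeff_zero_succ (n : ℕ) : ((n : ℚ[X]) + 1) * (plethExp 1 (n + 1)).coeff 0 =
    (X + (n : ℚ[X])) * (plethExp 1 n).coeff 0 := by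
  have hc : ∀ (n : ℕ) (f : Qmt), ((n : Qmt) * f).coeff 0 = (n : ℚ[X]) * f.coeff 0 := fun n f => by
    rw [mul_coeff_zero]; simp
  have key : ∀ n : ℕ, (n : ℚ[X]) * (plethExp 1 n).coeff 0 =
      X * ∑ b ∈ Finset.range n, (plethExp 1 b).coeff 0 := by
    intro n
    rw [← hc, natCast_mul_plethExp, finsetSum_coeff,
      ← Finset.Nat.sum_antidiagonal_swap, Finset.Nat.sum_antidiagonal_eq_sum_range_succ_mk,
      Finset.sum_range_succ, Finset.mul_sum]
    simp only [Prod.swap, Nat.sub_self, plethLog_zero, mul_zero, zero_mul, coeff_zero, add_zero]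
    refine Finset.sum_congr rfl fun b hb => ?_
    rw [mul_coeff_zero, hc, plethLog_one_coeff_zero]
    simp at hb; omega
  have h1 := key (n + 1)
  rw [Finset.sum_range_succ, mul_add, ← key n] at h1
  push_cast at h1
  linear_combination h1

/-- If `e` has logarithmic derivative `θL` with respect to `θ = x d/dx`, then `L` is a logarithm
of `e` for the derivation `d/dt` as well. -/
lemma derivative_of_natCast_mul {e L : ℕ → Qmt} (he : e 0 = 1) (hL : L 0 = 0)
    (h : ∀ n : ℕ, (n : Qmt) * e n = ∑ a ∈ antidiagonal n, ((a.1 : Qmt) * L a.1) * e a.2) (n : ℕ) :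
    derivative (e n) = ∑ a ∈ antidiagonal n, derivative (L a.1) * e a.2 := by
  let D : PowerSeries Qmt → PowerSeries Qmt := fun f =>
    PowerSeries.mk fun n => derivative (PowerSeries.coeff n f)
  let θ : PowerSeries Qmt → PowerSeries Qmt := fun f =>
    PowerSeries.mk fun n => (n : Qmt) * PowerSeries.coeff n f
  have hD : ∀ f g, D (f * g) = D f * g + f * D g := fun f g => by
    ext1 n
    simp [D, PowerSeries.coeff_mul, Finset.sum_add_distrib]
  have hθ : ∀ f g, θ (f * g) = θ f * g + f * θ g := fun f g => by
    ext1 n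
    simp only [θ, PowerSeries.coeff_mul, PowerSeries.coeff_mk, map_add, Finset.mul_sum,
      ← Finset.sum_add_distrib]
    refine Finset.sum_congr rfl fun a ha => ?_
    rw [← Finset.HasAntidiagonal.mem_antidiagonal.1 ha]
    push_cast; ring
  have hDsub : ∀ f g, θ (f - g) = θ f - θ g := fun f g => by
    ext1 n; simp [θ, mul_sub]
  have hcomm : ∀ f, θ (D f) = D (θ f) := fun f => by
    ext1 n; simp [θ, D]
  set E := PowerSeries.mk e with hE
  set Λ := PowerSeries.mk L with hΛ
  have h1 : θ E = θ Λ * E := by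
    ext1 n
    simp only [θ, E, Λ, PowerSeries.coeff_mul, PowerSeries.coeff_mk]
    exact h n
  set W := D E - D Λ * E with hW
  have h2 : θ W = θ Λ * W := by
    rw [hW, hDsub, hθ, hcomm, hcomm, h1, hD]
    ring
  have h3 : ∀ n, PowerSeries.coeff n W = 0 := by
    intro n
    induction n using Nat.strong_induction_on with
    | _ n ih =>
      by_cases hn : n = 0
      · subst hn
        simp [W, D, E, Λ, he, hL]
      · have h4 := congrArg (PowerSeries.coeff n) h2
        rw [PowerSeries.coeff_mul, Finset.sum_eq_zero] at h4
        · simpa [θ, hn] using h4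
        · rintro ⟨a, b⟩ hab
          rw [Finset.HasAntidiagonal.mem_antidiagonal] at hab
          simp only at hab ⊢
          by_cases ha : a = 0
          · subst ha; simp [θ]
          · rw [ih b (by omega), mul_zero]
  have h5 := h3 n
  rw [hW, map_sub, sub_eq_zero, PowerSeries.coeff_mul] at h5
  simpa [D, E, Λ] using h5

end MDegree

section ExpPolynomials

open Finset.HasAntidiagonal (antidiagonal)

/-- The span of the series `p(z) e^{bz}` with `p` a polynomial and `b ≤ a`. -/
noncomputable def expPoly (a : ℕ) : Submodule ℚ (PowerSeries ℚ) :=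
  Submodule.span ℚ {f | ∃ b ≤ a, ∃ p : ℚ[X], f = (p : PowerSeries ℚ) * PowerSeries.exp ℚ ^ b}

lemma coe_mul_exp_pow_mem {a b : ℕ} (h : b ≤ a) (p : ℚ[X]) :
    (p : PowerSeries ℚ) * PowerSeries.exp ℚ ^ b ∈ expPoly a :=
  Submodule.subset_span ⟨b, h, p, rfl⟩

lemma expPoly_mono {a b : ℕ} (h : a ≤ b) : expPoly a ≤ expPoly b :=
  Submodule.span_mono fun _ ⟨c, hc, p, hf⟩ => ⟨c, hc.trans h, p, hf⟩

lemma mul_mem_expPoly {a b : ℕ} {f g : PowerSeries ℚ} (hf : f ∈ expPoly a) (hg : g ∈ expPoly b) :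
    f * g ∈ expPoly (a + b) := by
  have h := Submodule.mul_mem_mul hf hg
  rw [expPoly, expPoly, Submodule.span_mul_span] at h
  refine Submodule.span_le.2 ?_ h
  rintro _ ⟨_, ⟨c, hc, p, rfl⟩, _, ⟨d, hd, q, rfl⟩, rfl⟩
  have : (p : PowerSeries ℚ) * PowerSeries.exp ℚ ^ c * (q * PowerSeries.exp ℚ ^ d) =
      ((p * q : ℚ[X]) : PowerSeries ℚ) * PowerSeries.exp ℚ ^ (c + d) := by
    rw [Polynomial.coe_mul]; ring
  simp only [this]
  exact coe_mul_exp_pow_mem (by omega) _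

lemma mem_expPoly_zero {f : PowerSeries ℚ} {N : ℕ} (h : ∀ n, N ≤ n → PowerSeries.coeff n f = 0) :
    f ∈ expPoly 0 := by
  have : f = (PowerSeries.trunc N f : ℚ[X]) * PowerSeries.exp ℚ ^ 0 := by
    ext n
    rw [pow_zero, mul_one, Polynomial.coeff_coe, PowerSeries.coeff_trunc]
    split_ifs with hn
    · rfl
    · exact h n (by omega)
  rw [this]
  exact coe_mul_exp_pow_mem le_rfl _

/-- Power series in `s` whose coefficients all lie in `expPoly a`. -/
noncomputable def expFil (a : ℕ) : Submodule ℚ (PowerSeries (PowerSeries ℚ)) where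
  carrier := {F | ∀ j, PowerSeries.coeff j F ∈ expPoly a}
  zero_mem' := fun j => by simp
  add_mem' := fun {F G} hF hG j => by rw [map_add]; exact add_mem (hF j) (hG j)
  smul_mem' := fun c F hF j => by
    have : PowerSeries.coeff j (c • F) = c • PowerSeries.coeff j F := rfl
    rw [this]
    exact Submodule.smul_mem _ c (hF j)

lemma expFil_mono {a b : ℕ} (h : a ≤ b) : expFil a ≤ expFil b :=
  fun _ hF j => expPoly_mono h (hF j)

lemma mul_mem_expFil {a b : ℕ} {F G : PowerSeries (PowerSeries ℚ)} (hF : F ∈ expFil a)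
    (hG : G ∈ expFil b) : F * G ∈ expFil (a + b) := fun j => by
  rw [PowerSeries.coeff_mul]
  exact sum_mem fun x _ => mul_mem_expPoly (hF _) (hG _)

lemma eq_zero_of_derivative_eq_mul {a : ℚ} {f : PowerSeries ℚ}
    (h : PowerSeries.derivative ℚ f = a • f) (h0 : PowerSeries.coeff 0 f = 0) : f = 0 := by
  ext n
  induction n with
  | zero => simpa using h0
  | succ n ih =>
    have h1 := congrArg (PowerSeries.coeff n) h
    rw [PowerSeries.coeff_derivative, map_smul, ih, map_zero, smul_zero] at h1
    rw [map_zero]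
    exact (mul_eq_zero.1 h1).resolve_right (by positivity)

lemma exists_antiderivative (G : ℚ[X]) : ∃ H : ℚ[X], derivative H = G ∧ H.coeff 0 = 0 := by
  induction G using Polynomial.induction_on' with
  | add p q hp hq =>
    obtain ⟨H, h1, h2⟩ := hp
    obtain ⟨K, h3, h4⟩ := hq
    exact ⟨H + K, by rw [derivative_add, h1, h3], by rw [coeff_add, h2, h4, add_zero]⟩
  | monomial n c =>
    refine ⟨monomial (n + 1) (c / (n + 1)), ?_, by simp [coeff_monomial]⟩
    rw [derivative_monomial]
    congr 1
    push_cast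
    field_simp

lemma derivative_exp_pow (a : ℕ) : PowerSeries.derivative ℚ (PowerSeries.exp ℚ ^ a) =
    (a : ℚ) • PowerSeries.exp ℚ ^ a := by
  rw [PowerSeries.derivative_pow, PowerSeries.derivative_exp, PowerSeries.smul_eq_C_mul]
  rcases a with - | a
  · simp
  · simp [pow_succ, mul_assoc]

/-- Solutions of `(1 - s z) ∂_z F = a F`, `F|_{z = 0} = 1`, have coefficients `p_j(z) e^{az}` with
`p_j` of degree at most `2 j` and known top coefficient. -/
lemma exists_coeff_eq_mul_exp_pow (a : ℕ) (F : ℕ → PowerSeries ℚ)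
    (h0 : PowerSeries.derivative ℚ (F 0) = (a : ℚ) • F 0)
    (hs : ∀ j, PowerSeries.derivative ℚ (F (j + 1)) =
      (a : ℚ) • F (j + 1) + PowerSeries.X * PowerSeries.derivative ℚ (F j))
    (c0 : PowerSeries.coeff 0 (F 0) = 1) (cs : ∀ j, PowerSeries.coeff 0 (F (j + 1)) = 0) (j : ℕ) :
    ∃ Y : ℚ[X], Y.natDegree ≤ 2 * j ∧ Y.coeff (2 * j) = (a : ℚ) ^ j / (2 ^ j * j.factorial) ∧
      F j = (Y : PowerSeries ℚ) * PowerSeries.exp ℚ ^ a := by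
  have hexp : PowerSeries.coeff 0 (PowerSeries.exp ℚ ^ a) = 1 := by simp
  induction j with
  | zero =>
    refine ⟨1, by simp, by simp, ?_⟩
    rw [Polynomial.coe_one, one_mul, ← sub_eq_zero]
    refine eq_zero_of_derivative_eq_mul (a := a) ?_ ?_
    · rw [map_sub, h0, derivative_exp_pow, smul_sub]
    · rw [map_sub, c0, hexp, sub_self]
  | succ j ih =>
    obtain ⟨Y, hdeg, htop, hF⟩ := ih
    obtain ⟨H, hH, hH0⟩ := exists_antiderivative (X * (C (a : ℚ) * Y + derivative Y))
    have hcoeff : ∀ m, H.coeff (m + 2) * (m + 2) = a * Y.coeff m +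
        Y.coeff (m + 1) * (m + 1) := fun m => by
      have := congrArg (fun p => p.coeff (m + 1)) hH
      simp only [coeff_derivative, coeff_X_mul, coeff_add, coeff_C_mul] at this
      push_cast at this
      linear_combination this
    refine ⟨H, ?_, ?_, ?_⟩
    · rw [natDegree_le_iff_coeff_eq_zero]
      intro N hN
      obtain ⟨m, rfl⟩ : ∃ m, N = m + 2 := ⟨N - 2, by omega⟩
      have h1 := hcoeff m
      rw [coeff_eq_zero_of_natDegree_lt (p := Y) (by omega),
        coeff_eq_zero_of_natDegree_lt (p := Y) (by omega)] at h1
      have h2 : H.coeff (m + 2) * ((m : ℚ) + 2) = 0 := by rw [h1]; ring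
      exact (mul_eq_zero.1 h2).resolve_right (by positivity)
    · have h1 := hcoeff (2 * j)
      rw [coeff_eq_zero_of_natDegree_lt (n := 2 * j + 1) (by omega), htop] at h1
      have h2 : ((2 * j : ℕ) : ℚ) + 2 ≠ 0 := by positivity
      rw [mul_add, mul_one, ← mul_left_inj' h2, h1, Nat.factorial_succ]
      push_cast
      field_simp
      ring
    · have hd : PowerSeries.derivative ℚ (H : PowerSeries ℚ) =
          PowerSeries.X * ((a : ℚ) • (Y : PowerSeries ℚ) + PowerSeries.derivative ℚ Y) := by
        rw [PowerSeries.derivative_coe, hH, PowerSeries.derivative_coe, PowerSeries.smul_eq_C_mul]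
        have : ((C (a : ℚ) : ℚ[X]) : PowerSeries ℚ) = PowerSeries.C (a : ℚ) := Polynomial.coe_C _
        rw [Polynomial.coe_mul, Polynomial.coe_add, Polynomial.coe_mul, Polynomial.coe_X, this]
      rw [← sub_eq_zero]
      refine eq_zero_of_derivative_eq_mul (a := a) ?_ ?_
      · rw [map_sub, hs, hF, Derivation.leibniz, Derivation.leibniz, hd, derivative_exp_pow]
        simp only [smul_eq_mul, PowerSeries.smul_eq_C_mul]
        ring
      · rw [map_sub, cs, PowerSeries.coeff_mul, Finset.Nat.antidiagonal_zero,
          Finset.sum_singleton, hexp, Polynomial.coeff_coe, hH0]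
        simp

end ExpPolynomials

section Asymptotics

open Filter Topology

/-- The sequence `n! f_n` is asymptotic to `l * a^n * n^e` (in the sense that the quotient by
`a^n * n^e` tends to `l`). -/
def CoeffTendsto (a e : ℕ) (f : PowerSeries ℚ) (l : ℝ) : Prop :=
  Tendsto (fun n : ℕ => ((PowerSeries.coeff n f : ℚ) : ℝ) * n.factorial / ((a : ℝ) ^ n * (n : ℝ) ^ e))
    atTop (𝓝 l)

lemma CoeffTendsto.add {a e : ℕ} {f g : PowerSeries ℚ} {l m : ℝ} (hf : CoeffTendsto a e f l)
    (hg : CoeffTendsto a e g m) : CoeffTendsto a e (f + g) (l + m) := by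
  refine (Tendsto.add hf hg).congr fun n => ?_
  rw [map_add]; push_cast; ring

lemma CoeffTendsto.smul {a e : ℕ} {f : PowerSeries ℚ} {l : ℝ} (c : ℚ) (hf : CoeffTendsto a e f l) :
    CoeffTendsto a e (c • f) (c * l) := by
  refine (Tendsto.const_mul (c : ℝ) hf).congr fun n => ?_
  rw [map_smul, smul_eq_mul]; push_cast; ring

lemma CoeffTendsto.zero (a e : ℕ) : CoeffTendsto a e 0 0 := by
  simp [CoeffTendsto]

lemma CoeffTendsto.sum {ι : Type*} {a e : ℕ} (s : Finset ι) {f : ι → PowerSeries ℚ} {l : ι → ℝ}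
    (h : ∀ i ∈ s, CoeffTendsto a e (f i) (l i)) :
    CoeffTendsto a e (∑ i ∈ s, f i) (∑ i ∈ s, l i) := by
  classical
  induction s using Finset.induction_on with
  | empty => simpa using CoeffTendsto.zero a e
  | insert i s hi ih =>
    rw [Finset.sum_insert hi, Finset.sum_insert hi]
    exact (h i (by simp)).add (ih fun j hj => h j (by simp [hj]))

lemma coeff_X_pow_mul_exp_pow (i b n : ℕ) :
    PowerSeries.coeff n ((PowerSeries.X : PowerSeries ℚ) ^ i * PowerSeries.exp ℚ ^ b) *
      n.factorial = (n.descFactorial i : ℚ) * (b : ℚ) ^ (n - i) := by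
  rw [PowerSeries.coeff_X_pow_mul', PowerSeries.exp_pow_eq_rescale_exp]
  split_ifs with h
  · rw [PowerSeries.coeff_rescale, PowerSeries.coeff_exp]
    have h1 := Nat.factorial_mul_descFactorial h
    rw [← h1]
    have : ((n - i).factorial : ℚ) ≠ 0 := by positivity
    simp
    field_simp
  · rw [Nat.descFactorial_of_lt (by omega)]
    simp

lemma coeffTendsto_X_pow_mul_exp_pow_of_lt {a b : ℕ} (h : b < a) (i e : ℕ) :
    CoeffTendsto a e (PowerSeries.X ^ i * PowerSeries.exp ℚ ^ b) 0 := by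
  have ha : (0 : ℝ) < a := by exact_mod_cast (by omega : 0 < a)
  have hr : |(b : ℝ) / a| < 1 := by
    rw [abs_of_nonneg (by positivity), div_lt_one ha]; exact_mod_cast h
  have h1 := tendsto_pow_const_mul_const_pow_of_abs_lt_one i hr
  rcases Nat.eq_zero_or_pos b with rfl | hb
  · refine tendsto_const_nhds.congr' ?_
    filter_upwards [eventually_gt_atTop i] with n hn
    have := coeff_X_pow_mul_exp_pow i 0 n
    rw [Nat.cast_zero, zero_pow (by omega), mul_zero] at this
    have h2 : PowerSeries.coeff n ((PowerSeries.X : PowerSeries ℚ) ^ i *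
      PowerSeries.exp ℚ ^ 0) = 0 := (mul_eq_zero.1 this).resolve_right (by positivity)
    rw [h2]; simp
  · have h2 := h1.const_mul (((b : ℝ) ^ i)⁻¹)
    rw [mul_zero] at h2
    refine squeeze_zero' (Eventually.of_forall fun n => ?_) ?_ h2
    · have := coeff_X_pow_mul_exp_pow i b n
      have h3 : ((PowerSeries.coeff n ((PowerSeries.X : PowerSeries ℚ) ^ i *
        PowerSeries.exp ℚ ^ b) : ℚ) : ℝ) * n.factorial = n.descFactorial i * (b : ℝ) ^ (n - i) := by
        exact_mod_cast this
      rw [h3]; positivity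
    · filter_upwards [eventually_ge_atTop (i + 1)] with n hn
      have := coeff_X_pow_mul_exp_pow i b n
      have h3 : ((PowerSeries.coeff n ((PowerSeries.X : PowerSeries ℚ) ^ i *
        PowerSeries.exp ℚ ^ b) : ℚ) : ℝ) * n.factorial = n.descFactorial i * (b : ℝ) ^ (n - i) := by
        exact_mod_cast this
      have hb' : (0 : ℝ) < b := by exact_mod_cast hb
      have hn1 : (1 : ℝ) ≤ n := by exact_mod_cast (by omega : 1 ≤ n)
      have h4 : (n.descFactorial i : ℝ) ≤ (n : ℝ) ^ i := by
        exact_mod_cast Nat.descFactorial_le_pow n i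
      have h5 : (b : ℝ) ^ (n - i) = (b : ℝ) ^ n * ((b : ℝ) ^ i)⁻¹ := pow_sub₀ _ hb'.ne' (by omega)
      have h6 : (1 : ℝ) ≤ (n : ℝ) ^ e := one_le_pow₀ hn1
      rw [h3, h5, div_pow]
      calc _ ≤ (n : ℝ) ^ i * ((b : ℝ) ^ n * ((b : ℝ) ^ i)⁻¹) / ((a : ℝ) ^ n * 1) := by gcongr
        _ = _ := by rw [mul_one]; ring

lemma coeffTendsto_of_mem_expPoly {a k : ℕ} (h : k < a) (e : ℕ) {f : PowerSeries ℚ}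
    (hf : f ∈ expPoly k) : CoeffTendsto a e f 0 := by
  induction hf using Submodule.span_induction with
  | mem f hf =>
    obtain ⟨b, hb, p, rfl⟩ := hf
    have : (p : PowerSeries ℚ) * PowerSeries.exp ℚ ^ b = ∑ i ∈ Finset.range (p.natDegree + 1),
        p.coeff i • (PowerSeries.X ^ i * PowerSeries.exp ℚ ^ b) := by
      conv_lhs => rw [p.as_sum_range_C_mul_X_pow]
      rw [← Polynomial.coeToPowerSeries.ringHom_apply, map_sum, Finset.sum_mul]
      refine Finset.sum_congr rfl fun i _ => ?_
      simp [PowerSeries.smul_eq_C_mul, mul_assoc]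
    rw [this]
    have h2 := CoeffTendsto.sum (Finset.range (p.natDegree + 1)) fun i _ =>
      (coeffTendsto_X_pow_mul_exp_pow_of_lt (by omega : b < a) i e).smul (p.coeff i)
    simpa using h2
  | zero => exact CoeffTendsto.zero a e
  | add f g _ _ hf hg => simpa using hf.add hg
  | smul c f _ hf => simpa using hf.smul c

lemma tendsto_descFactorial_div_pow (i : ℕ) :
    Tendsto (fun n : ℕ => (n.descFactorial i : ℝ) / (n : ℝ) ^ i) atTop (𝓝 1) := by
  induction i with
  | zero => simp
  | succ i ih =>
    have h1 : Tendsto (fun n : ℕ => ((n - i : ℕ) : ℝ) / n) atTop (𝓝 1) := by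
      have h2 : Tendsto (fun n : ℕ => 1 - (i : ℝ) / n) atTop (𝓝 (1 - 0)) :=
        tendsto_const_nhds.sub (tendsto_const_div_atTop_nhds_zero_nat (i : ℝ))
      rw [sub_zero] at h2
      refine h2.congr' ?_
      filter_upwards [eventually_ge_atTop (i + 1)] with n hn
      have : (n : ℝ) ≠ 0 := by exact_mod_cast (by omega : n ≠ 0)
      rw [Nat.cast_sub (by omega)]
      field_simp
    have h2 := h1.mul ih
    rw [one_mul] at h2
    refine h2.congr fun n => ?_
    rw [Nat.descFactorial_succ, pow_succ]
    push_cast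
    rw [div_mul_div_comm]
    ring

lemma coeffTendsto_X_pow_mul_exp_pow {a i e : ℕ} (ha : 0 < a) (h : i ≤ e) :
    CoeffTendsto a e (PowerSeries.X ^ i * PowerSeries.exp ℚ ^ a)
      (if i = e then ((a : ℝ) ^ i)⁻¹ else 0) := by
  have h1 : Tendsto (fun n : ℕ => ((n : ℝ) ^ (e - i))⁻¹) atTop (𝓝 (if i = e then 1 else 0)) := by
    split_ifs with hi
    · subst hi; simp
    · have : e - i ≠ 0 := by omega
      exact tendsto_inv_atTop_zero.comp ((tendsto_pow_atTop this).comp tendsto_natCast_atTop_atTop)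
  have h2 := ((tendsto_descFactorial_div_pow i).mul h1).const_mul (((a : ℝ) ^ i)⁻¹)
  have h3 : ((a : ℝ) ^ i)⁻¹ * (1 * if i = e then (1 : ℝ) else 0) =
    if i = e then ((a : ℝ) ^ i)⁻¹ else 0 := by split_ifs <;> simp
  rw [h3] at h2
  refine h2.congr' ?_
  filter_upwards [eventually_ge_atTop (i + 1)] with n hn
  have h4 : ((PowerSeries.coeff n ((PowerSeries.X : PowerSeries ℚ) ^ i *
      PowerSeries.exp ℚ ^ a) : ℚ) : ℝ) * n.factorial = n.descFactorial i * (a : ℝ) ^ (n - i) := by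
    exact_mod_cast coeff_X_pow_mul_exp_pow i a n
  have ha' : (0 : ℝ) < a := by exact_mod_cast ha
  have hn' : (0 : ℝ) < n := by exact_mod_cast (by omega : 0 < n)
  have h5 : (a : ℝ) ^ n = (a : ℝ) ^ (n - i) * (a : ℝ) ^ i := by
    rw [← pow_add, Nat.sub_add_cancel (by omega)]
  have h6 : (n : ℝ) ^ e = (n : ℝ) ^ (e - i) * (n : ℝ) ^ i := by
    rw [← pow_add, Nat.sub_add_cancel h]
  rw [h4, h5, h6]
  field_simp

lemma coeffTendsto_coe_mul_exp_pow {a e : ℕ} (ha : 0 < a) {Y : ℚ[X]} (hY : Y.natDegree ≤ e) :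
    CoeffTendsto a e (Y * PowerSeries.exp ℚ ^ a) (Y.coeff e / (a : ℝ) ^ e) := by
  have : (Y : PowerSeries ℚ) * PowerSeries.exp ℚ ^ a = ∑ i ∈ Finset.range (e + 1),
      Y.coeff i • (PowerSeries.X ^ i * PowerSeries.exp ℚ ^ a) := by
    conv_lhs => rw [Y.as_sum_range_C_mul_X_pow' (Nat.lt_succ_of_le hY)]
    rw [← Polynomial.coeToPowerSeries.ringHom_apply, map_sum, Finset.sum_mul]
    refine Finset.sum_congr rfl fun i _ => ?_
    simp [PowerSeries.smul_eq_C_mul, mul_assoc]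
  rw [this]
  have h2 := CoeffTendsto.sum (Finset.range (e + 1)) fun i hi =>
    (coeffTendsto_X_pow_mul_exp_pow (e := e) ha
      (Nat.lt_succ_iff.1 (Finset.mem_range.1 hi))).smul (Y.coeff i)
  convert h2 using 1
  simp [div_eq_mul_inv]

/-- Log-concavity of coefficients of series with the asymptotics of `c • U^a`. -/
lemma eventually_mul_le_sq {a : ℕ} (ha : 0 < a) {c : ℚ} (hc : c ≠ 0) {F : ℕ → PowerSeries ℚ}
    (hF : ∀ j, CoeffTendsto a (2 * j) (F j) (c / ((2 * a) ^ j * j.factorial))) (j : ℕ) :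
    ∀ᶠ n in atTop, PowerSeries.coeff n (F j) * PowerSeries.coeff n (F (j + 2)) ≤
      PowerSeries.coeff n (F (j + 1)) ^ 2 := by
  have hc' : (c : ℝ) ≠ 0 := by exact_mod_cast hc
  have ha' : (0 : ℝ) < a := by exact_mod_cast ha
  have h := (hF j).mul (hF (j + 2))
  have h' := (hF (j + 1)).pow 2
  have hlt : (c : ℝ) / ((2 * a) ^ j * j.factorial) *
      (c / ((2 * a) ^ (j + 2) * (j + 2).factorial)) <
      ((c : ℝ) / ((2 * a) ^ (j + 1) * (j + 1).factorial)) ^ 2 := by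
    rw [div_mul_div_comm, div_pow, ← sq]
    refine div_lt_div_of_pos_left (by positivity) (by positivity) ?_
    rw [Nat.factorial_succ (j + 1), Nat.factorial_succ j]
    have hf : (0 : ℝ) < j.factorial := by positivity
    push_cast
    have : (0 : ℝ) < (2 * a) ^ (2 * j + 2) * (j.factorial : ℝ) ^ 2 * (j + 1) := by positivity
    rw [← sub_pos]
    refine this.trans_eq ?_
    ring
  filter_upwards [h.eventually_lt h' hlt, eventually_ge_atTop 1] with n hn hn1
  have hn' : (0 : ℝ) < n := by exact_mod_cast hn1
  have hD : (0 : ℝ) < ((a : ℝ) ^ n * (n : ℝ) ^ (2 * (j + 1))) ^ 2 := by positivity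
  rw [div_mul_div_comm, div_pow, show (a : ℝ) ^ n * (n : ℝ) ^ (2 * j) *
    ((a : ℝ) ^ n * (n : ℝ) ^ (2 * (j + 2))) = ((a : ℝ) ^ n * (n : ℝ) ^ (2 * (j + 1))) ^ 2 by ring,
    div_lt_div_iff_of_pos_right hD] at hn
  have hfac : (0 : ℝ) < (n.factorial : ℝ) ^ 2 := by positivity
  have h3 : ((PowerSeries.coeff n (F j) : ℚ) : ℝ) * (PowerSeries.coeff n (F (j + 2)) : ℚ) <
      ((PowerSeries.coeff n (F (j + 1)) : ℚ) : ℝ) ^ 2 := by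
    refine lt_of_mul_lt_mul_right ?_ hfac.le
    calc _ = _ := by ring
      _ < _ := hn
      _ = _ := by ring
  exact_mod_cast h3.le

end Asymptotics

section LeadingTerms

open Finset.HasAntidiagonal (antidiagonal mem_antidiagonal)

/-- The sequence with `cSeq 0 = 1` and `(k + 1) c_{k+1} = ∑_{a + b = k} (a + 1) c_a c_b`. -/
noncomputable def cSeq : ℕ → ℚ
  | 0 => 1
  | k + 1 => (∑ i : Fin (k + 1), ((i : ℚ) + 1) * (cSeq i * cSeq (k - i))) / (k + 1)

lemma cSeq_zero : cSeq 0 = 1 := by rw [cSeq]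

lemma mul_cSeq_succ (k : ℕ) : ((k : ℚ) + 1) * cSeq (k + 1) =
    ∑ x ∈ antidiagonal k, ((x.1 : ℚ) + 1) * (cSeq x.1 * cSeq x.2) := by
  rw [cSeq, mul_div_cancel₀ _ (by positivity), Finset.Nat.sum_antidiagonal_eq_sum_range_succ_mk,
    Finset.sum_range]

lemma cSeq_pos (k : ℕ) : 0 < cSeq k := by
  induction k using Nat.strong_induction_on with
  | _ k ih =>
    obtain _ | k := k
    · rw [cSeq_zero]; exact one_pos
    · have h : (0 : ℚ) < (k + 1) * cSeq (k + 1) := by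
        rw [mul_cSeq_succ]
        refine Finset.sum_pos (fun x hx => ?_) ⟨(0, k), by simp⟩
        rw [mem_antidiagonal] at hx
        have h1 := ih x.1 (by omega)
        have h2 := ih x.2 (by omega)
        positivity
      exact pos_of_mul_pos_right h (by positivity)

lemma cSeq_succ_sub (k : ℕ) :
    cSeq (k + 1) - 2⁻¹ * ∑ x ∈ antidiagonal k, cSeq x.1 * cSeq x.2 = cSeq (k + 1) / (k + 2) := by
  have h := mul_cSeq_succ k
  have h' := h
  rw [← Finset.Nat.sum_antidiagonal_swap] at h'
  have hsum : 2 * (((k : ℚ) + 1) * cSeq (k + 1)) =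
      (k + 2) * ∑ x ∈ antidiagonal k, cSeq x.1 * cSeq x.2 := by
    rw [two_mul]
    nth_rewrite 1 [h]
    rw [h', ← Finset.sum_add_distrib, Finset.mul_sum]
    refine Finset.sum_congr rfl fun x hx => ?_
    rw [mem_antidiagonal] at hx
    rw [← hx, Prod.fst_swap, Prod.snd_swap]
    push_cast
    ring
  have h2 : (k : ℚ) + 2 ≠ 0 := by positivity
  field_simp
  linear_combination hsum

lemma mem_of_smul_mem {M : Submodule ℚ (PowerSeries (PowerSeries ℚ))} {c : ℚ} (hc : c ≠ 0)
    {x : PowerSeries (PowerSeries ℚ)} (h : c • x ∈ M) : x ∈ M := by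
  have := M.smul_mem c⁻¹ h
  rwa [smul_smul, inv_mul_cancel₀ hc, one_smul] at this

/-- Leading terms of a system of recursions in the filtration `expFil`. -/
lemma leading_terms {U : PowerSeries (PowerSeries ℚ)} {e l a l' q : ℕ → PowerSeries (PowerSeries ℚ)}
    (hU : ∀ n, U ^ n ∈ expFil n) (he0 : e 0 = U) (hq0 : q 0 ∈ expFil 0)
    (hl : ∀ k, l k - q k ∈ expFil 0) (hl' : ∀ k, l' (k + 1) - q k ∈ expFil 0)
    (ha0 : a 0 = 1) (ha1 : a 1 ∈ expFil 0) (ha : ∀ k, a (k + 2) - e k ∈ expFil 0)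
    (hE : ∀ k : ℕ, ((k : ℚ) + 1) • e (k + 1) =
      ∑ x ∈ antidiagonal k, ((x.1 : ℚ) + 1) • (l (x.1 + 1) * e x.2))
    (hA : ∀ k : ℕ, ((k : ℚ) + 1) • a (k + 1) =
      ∑ x ∈ antidiagonal k, ((x.1 : ℚ) + 1) • (l' (x.1 + 1) * a x.2)) (k : ℕ) :
    e k - cSeq k • U ^ (k + 1) ∈ expFil k ∧ q k ∈ expFil k ∧ q (k + 1) - e k ∈ expFil k := by
  induction k using Nat.strong_induction_on with
  | _ k ih =>
    have he (i : ℕ) (hi : i < k) : e i ∈ expFil (i + 1) := by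
      have := add_mem (expFil_mono (Nat.le_succ i) (ih i hi).1)
        ((expFil (i + 1)).smul_mem (cSeq i) (hU (i + 1)))
      rwa [sub_add_cancel] at this
    have hqk : q k ∈ expFil k := by
      obtain _ | i := k
      · exact hq0
      · have := add_mem (expFil_mono (Nat.le_succ i) (ih i (by omega)).2.2) (he i (by omega))
        rwa [sub_add_cancel] at this
    refine ⟨?_, hqk, ?_⟩
    · obtain _ | i := k
      · rw [he0, cSeq_zero, one_smul, zero_add, pow_one, sub_self]
        exact zero_mem _
      · refine mem_of_smul_mem (c := (i : ℚ) + 1) (by positivity) ?_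
        rw [smul_sub, smul_smul, hE, mul_cSeq_succ, Finset.sum_smul, ← Finset.sum_sub_distrib]
        refine sum_mem fun x hx => ?_
        rw [mem_antidiagonal] at hx
        rw [mul_smul, ← smul_sub]
        refine Submodule.smul_mem _ _ ?_
        have h1 : l (x.1 + 1) - cSeq x.1 • U ^ (x.1 + 1) ∈ expFil x.1 := by
          have := add_mem (add_mem (expFil_mono (Nat.zero_le x.1) (hl (x.1 + 1)))
            (ih x.1 (by omega)).2.2) (ih x.1 (by omega)).1
          convert this using 1
          abel
        have h2 := mul_mem_expFil h1 (he x.2 (by omega))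
        have h3 := mul_mem_expFil ((expFil (x.1 + 1)).smul_mem (cSeq x.1) (hU (x.1 + 1)))
          (ih x.2 (by omega)).1
        rw [show x.1 + (x.2 + 1) = i + 1 by omega] at h2
        rw [show x.1 + 1 + x.2 = i + 1 by omega] at h3
        convert add_mem h2 h3 using 1
        rw [sub_mul, mul_sub, smul_mul_smul_comm, ← pow_add,
          show x.1 + 1 + (x.2 + 1) = i + 1 + 1 by omega]
        abel
    · have hA' := hA (k + 1)
      rw [Finset.Nat.antidiagonal_succ', Finset.sum_cons, Finset.sum_map, ha0, mul_one] at hA'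
      have h1 : a (k + 2) - l' (k + 2) ∈ expFil k := by
        refine mem_of_smul_mem (c := ((k + 1 : ℕ) : ℚ) + 1) (by positivity) ?_
        rw [smul_sub, hA', add_sub_cancel_left]
        refine sum_mem fun x hx => Submodule.smul_mem _ _ ?_
        rw [mem_antidiagonal] at hx
        have h2 : l' (x.1 + 1) ∈ expFil x.1 := by
          have hq : q x.1 ∈ expFil x.1 := by
            obtain h | h := (show x.1 ≤ k by omega).lt_or_eq
            · exact (ih _ h).2.1
            · rw [h]; exact hqk
          have := add_mem (expFil_mono (Nat.zero_le _) (hl' x.1)) hq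
          rwa [sub_add_cancel] at this
        have h3 : a (x.2 + 1) ∈ expFil x.2 := by
          obtain ⟨i, _ | y⟩ := x
          · exact ha1
          · have := add_mem (expFil_mono (Nat.zero_le _) (ha y)) (he y (by lia))
            rwa [sub_add_cancel] at this
        have := mul_mem_expFil h2 h3
        rwa [hx] at this
      have := sub_mem (sub_mem (expFil_mono (Nat.zero_le k) (ha k))
        (expFil_mono (Nat.zero_le k) (hl' (k + 1)))) h1
      convert this using 1
      abel

end LeadingTerms

section Layers

open Finset.HasAntidiagonal (antidiagonal mem_antidiagonal)

/-- Differentiation with respect to `z` on `ℚ⟦z⟧⟦s⟧`. -/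
noncomputable def zDerivation :
    Derivation ℚ (PowerSeries (PowerSeries ℚ)) (PowerSeries (PowerSeries ℚ)) :=
  Derivation.mk'
    { toFun := fun F => PowerSeries.mk fun j => PowerSeries.derivative ℚ (PowerSeries.coeff j F)
      map_add' := fun F G => by ext1 j; simp
      map_smul' := fun c F => by
        ext1 j
        have (G : PowerSeries (PowerSeries ℚ)) :
          PowerSeries.coeff j (c • G) = c • PowerSeries.coeff j G := rfl
        simp [this] }
    fun F G => by
      ext1 j
      simp only [LinearMap.coe_mk, AddHom.coe_mk, PowerSeries.coeff_mk, smul_eq_mul, map_add,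
        PowerSeries.coeff_mul, map_sum, Derivation.leibniz, Finset.sum_add_distrib]
      congr 1
      exact (Finset.Nat.sum_antidiagonal_swap (n := j)).symm

lemma coeff_zDerivation (F : PowerSeries (PowerSeries ℚ)) (j : ℕ) :
    PowerSeries.coeff j (zDerivation F) = PowerSeries.derivative ℚ (PowerSeries.coeff j F) := by
  simp [zDerivation]

lemma exists_coeff_pow_eq {U : PowerSeries (PowerSeries ℚ)}
    (c0 : PowerSeries.coeff 0 (PowerSeries.coeff 0 U) = 1)
    (cs : ∀ j, PowerSeries.coeff 0 (PowerSeries.coeff (j + 1) U) = 0)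
    (h0 : PowerSeries.derivative ℚ (PowerSeries.coeff 0 U) = PowerSeries.coeff 0 U)
    (hs : ∀ j, PowerSeries.derivative ℚ (PowerSeries.coeff (j + 1) U) =
      PowerSeries.coeff (j + 1) U +
        PowerSeries.X * PowerSeries.derivative ℚ (PowerSeries.coeff j U)) (a j : ℕ) :
    ∃ Y : ℚ[X], Y.natDegree ≤ 2 * j ∧ Y.coeff (2 * j) = a ^ j / (2 ^ j * j.factorial) ∧
      PowerSeries.coeff j (U ^ a) = (Y : PowerSeries ℚ) * PowerSeries.exp ℚ ^ a := by
  have hU : zDerivation U = U + PowerSeries.X * (PowerSeries.C PowerSeries.X * zDerivation U) := by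
    ext1 j
    obtain _ | j := j
    · rw [coeff_zDerivation, h0]; simp
    · simp [PowerSeries.coeff_succ_X_mul, PowerSeries.coeff_C_mul, coeff_zDerivation, hs]
  have hUa : zDerivation (U ^ a) = (a : ℚ) • U ^ a +
      PowerSeries.X * (PowerSeries.C PowerSeries.X * zDerivation (U ^ a)) := by
    obtain _ | b := a
    · simp
    · have : ((b + 1 : ℕ) : ℚ) • U ^ (b + 1) = (b + 1 : ℕ) • U ^ (b + 1) := Nat.cast_smul_eq_nsmul ..
      rw [this, Derivation.leibniz_pow, Nat.add_sub_cancel, smul_eq_mul, nsmul_eq_mul, nsmul_eq_mul]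
      linear_combination ((b + 1 : ℕ) : PowerSeries (PowerSeries ℚ)) * U ^ b * hU
  have hmap : PowerSeries.map PowerSeries.constantCoeff (U ^ a) = 1 := by
    have : PowerSeries.map PowerSeries.constantCoeff U = (1 : PowerSeries ℚ) := by
      ext j
      obtain _ | j := j
      · simpa using c0
      · simpa [PowerSeries.coeff_one] using cs j
    rw [map_pow, this, one_pow]
  have hconst (i : ℕ) : PowerSeries.coeff 0 (PowerSeries.coeff i (U ^ a)) =
      if i = 0 then 1 else 0 := by
    rw [← PowerSeries.coeff_one, ← hmap, PowerSeries.coeff_map]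
    simp
  have hsmul (i : ℕ) (c : ℚ) (G : PowerSeries (PowerSeries ℚ)) :
    PowerSeries.coeff i (c • G) = c • PowerSeries.coeff i G := rfl
  refine exists_coeff_eq_mul_exp_pow a (fun i => PowerSeries.coeff i (U ^ a)) ?_ (fun i => ?_)
    (by simpa using hconst 0) (fun i => by simpa using hconst (i + 1)) j
  · have := congrArg (PowerSeries.coeff 0) hUa
    rw [coeff_zDerivation, map_add, hsmul] at this
    simpa using this
  · have := congrArg (PowerSeries.coeff (i + 1)) hUa
    rwa [coeff_zDerivation, map_add, hsmul, PowerSeries.coeff_succ_X_mul, PowerSeries.coeff_C_mul,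
      coeff_zDerivation] at this

/-- The generating series `∑ (coefficient of m^{n-j} t^k in e_n) z^n s^j`. -/
noncomputable def layer (e : ℕ → Qmt) (k : ℕ) : PowerSeries (PowerSeries ℚ) :=
  PowerSeries.mk fun j => PowerSeries.mk fun n => (reflect n ((e n).coeff k)).coeff j

lemma coeff_layer (e : ℕ → Qmt) (k j n : ℕ) :
    PowerSeries.coeff n (PowerSeries.coeff j (layer e k)) =
      (reflect n ((e n).coeff k)).coeff j := by
  simp [layer]

lemma coeff_layer_of_le (e : ℕ → Qmt) (k : ℕ) {j n : ℕ} (h : j ≤ n) :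
    PowerSeries.coeff n (PowerSeries.coeff j (layer e k)) = ((e n).coeff k).coeff (n - j) := by
  rw [coeff_layer, coeff_reflect, revAt_le h]

lemma layer_sub (e f : ℕ → Qmt) (k : ℕ) :
    layer (fun n => e n - f n) k = layer e k - layer f k := by
  ext j n
  simp [coeff_layer, reflect_sub]

lemma reflect_sum {ι : Type*} (s : Finset ι) (f : ι → ℚ[X]) (n : ℕ) :
    reflect n (∑ i ∈ s, f i) = ∑ i ∈ s, reflect n (f i) :=
  map_sum (⟨⟨reflect n, reflect_zero⟩, fun p q => reflect_add p q n⟩ : ℚ[X] →+ ℚ[X]) f s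

lemma layer_mul {e f : ℕ → Qmt} (he : ∀ n, e n ∈ mDegLE n) (hf : ∀ n, f n ∈ mDegLE n) (k : ℕ) :
    layer (fun n => ∑ x ∈ antidiagonal n, e x.1 * f x.2) k =
      ∑ x ∈ antidiagonal k, layer e x.1 * layer f x.2 := by
  ext j n
  simp only [coeff_layer, map_sum, PowerSeries.coeff_mul, finsetSum_coeff, reflect_sum,
    Polynomial.coeff_mul]
  rw [Finset.sum_comm]
  refine Finset.sum_congr rfl fun x _ => ?_
  rw [Finset.sum_comm]
  refine Finset.sum_congr rfl fun y hy => ?_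
  rw [mem_antidiagonal] at hy
  rw [← hy, reflect_mul _ _ (he _ _) (hf _ _), Polynomial.coeff_mul]

lemma layer_derivative (e : ℕ → Qmt) (k : ℕ) :
    layer (fun n => derivative (e n)) k = ((k : ℚ) + 1) • layer e (k + 1) := by
  ext j n
  have (c : ℚ) (G : PowerSeries (PowerSeries ℚ)) :
    PowerSeries.coeff j (c • G) = c • PowerSeries.coeff j G := rfl
  have h : ((k : ℚ[X]) + 1) = C ((k : ℚ) + 1) := by simp
  rw [coeff_layer, coeff_derivative, this, PowerSeries.coeff_smul, coeff_layer, h, mul_comm,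
    reflect_C_mul, coeff_C_mul, smul_eq_mul]

lemma layer_congr {e f : ℕ → Qmt} {k l : ℕ} (h : ∀ n, (e n).coeff k = (f n).coeff l) :
    layer e k = layer f l := by
  ext j n
  rw [coeff_layer, coeff_layer, h]

lemma layer_mem_expFil_zero {e : ℕ → Qmt} {k N : ℕ}
    (h : ∀ n, N ≤ n → ((e n).coeff k).natDegree ≤ n / 2) : layer e k ∈ expFil 0 := fun j => by
  refine mem_expPoly_zero (N := N + 2 * j + 1) fun n hn => ?_
  rw [coeff_layer_of_le _ _ (by omega), coeff_eq_zero_of_natDegree_lt]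
  exact (h n (by omega)).trans_lt (by omega)

lemma layer_sub_mem_expFil_zero {e f : ℕ → Qmt} {k l N : ℕ}
    (h : ∀ n, N ≤ n → ((e n).coeff k - (f n).coeff l).natDegree ≤ n / 2) :
    layer e k - layer f l ∈ expFil 0 := fun j => by
  refine mem_expPoly_zero (N := N + 2 * j + 1) fun n hn => ?_
  rw [map_sub, map_sub, coeff_layer_of_le _ _ (by omega), coeff_layer_of_le _ _ (by omega),
    ← coeff_sub, coeff_eq_zero_of_natDegree_lt]
  exact (h n (by omega)).trans_lt (by omega)

end Layers

section LogConcavity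

open Finset.HasAntidiagonal (antidiagonal mem_antidiagonal)
open Filter

lemma derivative_mem_mDegLE {N : ℕ} {f : Qmt} (hf : f ∈ mDegLE N) : derivative f ∈ mDegLE N :=
  fun k => by
    rw [coeff_derivative, show ((k : ℚ[X]) + 1) = C ((k : ℚ) + 1) by simp, mul_comm]
    exact (natDegree_C_mul_le _ _).trans (hf _)

lemma layer_of_natCast_mul {e L : ℕ → Qmt} (he : e 0 = 1) (hL : L 0 = 0)
    (h : ∀ n : ℕ, (n : Qmt) * e n = ∑ a ∈ antidiagonal n, ((a.1 : Qmt) * L a.1) * e a.2)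
    (hedeg : ∀ n, e n ∈ mDegLE n) (hLdeg : ∀ n, L n ∈ mDegLE n) (k : ℕ) :
    ((k : ℚ) + 1) • layer e (k + 1) =
      ∑ x ∈ antidiagonal k, ((x.1 : ℚ) + 1) • (layer L (x.1 + 1) * layer e x.2) := by
  rw [← layer_derivative, layer_congr fun n => congrArg (coeff · k)
    (derivative_of_natCast_mul he hL h n), layer_mul (e := fun n => derivative (L n))
    (fun n => derivative_mem_mDegLE (hLdeg n)) hedeg]
  refine Finset.sum_congr rfl fun x _ => ?_
  rw [layer_derivative, smul_mul_assoc]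

lemma exists_coeff_layer_pow (a j : ℕ) :
    ∃ Y : ℚ[X], Y.natDegree ≤ 2 * j ∧ Y.coeff (2 * j) = a ^ j / (2 ^ j * j.factorial) ∧
      PowerSeries.coeff j (layer (plethExp 1) 0 ^ a) =
        (Y : PowerSeries ℚ) * PowerSeries.exp ℚ ^ a := by
  have key (n : ℕ) : ((n : ℚ[X]) + 1) * reflect (n + 1) ((plethExp 1 (n + 1)).coeff 0) =
      (1 + C (n : ℚ) * X) * reflect n ((plethExp 1 n).coeff 0) := by
    have h1 : reflect 1 (X + C (n : ℚ)) = 1 + C (n : ℚ) * X := by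
      rw [reflect_add, reflect_C, pow_one, reflect_one_X]
    have h2 := congrArg (reflect (1 + n)) (plethExp_one_coeff_zero_succ n)
    rw [show ((n : ℚ[X]) + 1) = C ((n : ℚ) + 1) by simp, reflect_C_mul, ← C_eq_natCast,
      reflect_mul _ _ (natDegree_X_add_C _).le (plethExp_mem_mDegLE (one_mem_mDegLE 0) n 0), h1,
      add_comm 1 n] at h2
    rw [← h2]
    simp
  have hC (n : ℕ) : ((n : ℚ[X]) + 1) = C ((n : ℚ) + 1) := by simp
  have h00 (j : ℕ) : PowerSeries.coeff 0 (PowerSeries.coeff j (layer (plethExp 1) 0)) =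
      if j = 0 then 1 else 0 := by
    rw [coeff_layer, plethExp_zero, coeff_one_zero, reflect_one, pow_zero, coeff_one]
  refine exists_coeff_pow_eq (by simpa using h00 0) (fun j => by simpa using h00 (j + 1)) ?_
    (fun j => ?_) a j
  · ext n
    have := congrArg (coeff · 0) (key n)
    simp only [hC, mul_coeff_zero, coeff_add, coeff_one_zero, coeff_X_zero, coeff_C_zero] at this
    rw [PowerSeries.coeff_derivative, coeff_layer, coeff_layer, mul_comm, this]
    ring
  · ext n
    have := congrArg (coeff · (j + 1)) (key n)
    simp only [hC, coeff_C_mul, add_mul, one_mul, coeff_add, mul_assoc, coeff_X_mul] at this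
    rw [PowerSeries.coeff_derivative, coeff_layer, mul_comm, add_mul, one_mul, this, map_add,
      coeff_layer]
    obtain _ | n := n
    · simp
    · rw [PowerSeries.coeff_succ_X_mul, PowerSeries.coeff_derivative, coeff_layer]
      push_cast
      ring

lemma layer_pow_mem_expFil (a : ℕ) : layer (plethExp 1) 0 ^ a ∈ expFil a := fun j => by
  obtain ⟨Y, -, -, h⟩ := exists_coeff_layer_pow a j
  rw [h]
  exact coe_mul_exp_pow_mem le_rfl Y

lemma coeffTendsto_of_sub_mem_expFil {G : PowerSeries (PowerSeries ℚ)} {k : ℕ} {c : ℚ}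
    (h : G - c • layer (plethExp 1) 0 ^ (k + 1) ∈ expFil k) (j : ℕ) :
    CoeffTendsto (k + 1) (2 * j) (PowerSeries.coeff j G)
      (c / ((2 * (k + 1 : ℕ)) ^ j * j.factorial)) := by
  obtain ⟨Y, hY, hYc, hYe⟩ := exists_coeff_layer_pow (k + 1) j
  have h1 := (coeffTendsto_coe_mul_exp_pow (Nat.succ_pos k) hY).smul c
  have h2 := h1.add (coeffTendsto_of_mem_expPoly (Nat.lt_succ_self k) (2 * j) (h j))
  have hs : PowerSeries.coeff j (c • layer (plethExp 1) 0 ^ (k + 1)) =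
    c • PowerSeries.coeff j (layer (plethExp 1) 0 ^ (k + 1)) := rfl
  rw [map_sub, hs, hYe, add_sub_cancel, hYc] at h2
  convert h2 using 1
  have : ((k + 1 : ℕ) : ℝ) ≠ 0 := by positivity
  rw [add_zero]
  push_cast at this ⊢
  rw [mul_comm 2 j, pow_mul, mul_pow]
  field_simp

lemma eventually_coeff_mul_le_sq {e : ℕ → Qmt} {k : ℕ} {c : ℚ} (hc : c ≠ 0)
    (h : layer e k - c • layer (plethExp 1) 0 ^ (k + 1) ∈ expFil k) {j : ℕ} (hj : 1 ≤ j) :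
    ∀ᶠ n in atTop, ((e n).coeff k).coeff (n - j - 1) * ((e n).coeff k).coeff (n - j + 1) ≤
      ((e n).coeff k).coeff (n - j) ^ 2 := by
  obtain ⟨i, rfl⟩ := Nat.exists_eq_add_of_le' hj
  filter_upwards [eventually_mul_le_sq (Nat.succ_pos k) hc (coeffTendsto_of_sub_mem_expFil h) i,
    eventually_ge_atTop (i + 2)] with n hn hni
  rw [coeff_layer_of_le _ _ (by omega), coeff_layer_of_le _ _ hni,
    coeff_layer_of_le _ _ (by omega)] at hn
  rw [mul_comm, show n - (i + 1) - 1 = n - (i + 2) by omega,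
    show n - (i + 1) + 1 = n - i by omega]
  exact hn

lemma layer_plethExp_one_sub_mem (k : ℕ) :
    layer (plethExp 1) k - cSeq k • layer (plethExp 1) 0 ^ (k + 1) ∈ expFil k := by
  have h1 := one_mem_mDegLE 0
  have hX := X_mem_mDegLE 0
  refine (leading_terms (l := layer (plethLog 1)) (a := layer (plethExp X))
    (l' := layer (plethLog X)) (q := layer Qplus) layer_pow_mem_expFil rfl
    (layer_mem_expFil_zero (N := 2) fun n hn => ?_)
    (fun k => layer_sub_mem_expFil_zero (N := 1) fun n hn => ?_)
    (fun k => layer_sub_mem_expFil_zero (N := 1) fun n hn => ?_) ?_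
    (layer_mem_expFil_zero (N := 2) fun n hn => ?_)
    (fun k => layer_sub_mem_expFil_zero (N := 2) fun n hn => ?_)
    (layer_of_natCast_mul (plethExp_zero _) (plethLog_zero _) (natCast_mul_plethExp _)
      (plethExp_mem_mDegLE h1) (plethLog_mem_mDegLE h1))
    (layer_of_natCast_mul (plethExp_zero _) (plethLog_zero _) (natCast_mul_plethExp _)
      (plethExp_mem_mDegLE hX) (plethLog_mem_mDegLE hX)) k).1
  · rw [Qplus_coeff_zero (by omega), natDegree_zero]
    exact Nat.zero_le _
  · have := plethLog_sub_mem_mDegLE h1 (show n ≠ 0 by omega) k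
    rwa [one_mul, coeff_sub] at this
  · have := plethLog_sub_mem_mDegLE hX (show n ≠ 0 by omega) (k + 1)
    rwa [coeff_sub, coeff_X_mul] at this
  · ext1 j
    ext1 n
    rw [coeff_layer]
    obtain _ | _ | n := n
    · rw [plethExp_zero, coeff_one_zero, reflect_one, pow_zero, coeff_one, PowerSeries.coeff_one]
      split_ifs <;> simp
    · rw [plethExp_one, mul_coeff_zero, coeff_X_zero, zero_mul, reflect_zero, coeff_zero,
        PowerSeries.coeff_one]
      split_ifs <;> simp [PowerSeries.coeff_one]
    · rw [plethExp_X (by omega), mul_coeff_zero, coeff_X_pow, if_neg (by omega), zero_mul,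
        reflect_zero, coeff_zero, PowerSeries.coeff_one]
      split_ifs <;> simp [PowerSeries.coeff_one]
  · rw [plethExp_X hn, coeff_X_pow_mul', if_neg (by omega), natDegree_zero]
    exact Nat.zero_le _
  · rw [plethExp_X hn, coeff_X_pow_mul, sub_self, natDegree_zero]
    exact Nat.zero_le _

/-- The polynomials `𝒬ₙ` with the values at `n < 2` replaced by zero. -/
noncomputable def truncExp (n : ℕ) : Qmt := if 2 ≤ n then plethExp 1 n else 0

lemma truncExp_mem_mDegLE (n : ℕ) : truncExp n ∈ mDegLE n := by
  rw [truncExp]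
  split_ifs
  · exact plethExp_mem_mDegLE (one_mem_mDegLE 0) n
  · exact zero_mem _

lemma sum_Icc_Qfull_mul (n : ℕ) : ∑ h ∈ Finset.Icc 2 (n - 2), Qfull h * Qfull (n - h) =
    ∑ x ∈ antidiagonal n, truncExp x.1 * truncExp x.2 := by
  rw [Finset.Nat.sum_antidiagonal_eq_sum_range_succ_mk]
  refine Eq.trans (Finset.sum_congr rfl fun h hh => ?_) (Finset.sum_subset ?_ ?_)
  · rw [Finset.mem_Icc] at hh
    rw [truncExp, truncExp, if_pos hh.1, if_pos (by omega), Qfull_eq_plethExp, Qfull_eq_plethExp]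
  · intro h hh
    rw [Finset.mem_Icc] at hh
    rw [Finset.mem_range]
    omega
  · intro h _ hh
    rw [Finset.mem_Icc] at hh
    simp only [truncExp]
    split_ifs <;> first | omega | simp

lemma layer_truncExp_sub_mem (k : ℕ) :
    layer truncExp k - cSeq k • layer (plethExp 1) 0 ^ (k + 1) ∈ expFil k := by
  have h : layer truncExp k - layer (plethExp 1) k ∈ expFil 0 :=
    layer_sub_mem_expFil_zero (N := 2) fun n hn => by simp [truncExp, hn]
  have := add_mem (expFil_mono (Nat.zero_le k) h) (layer_plethExp_one_sub_mem k)
  rwa [sub_add_sub_cancel] at this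

lemma mem_expFil_succ_of_sub_mem {G : PowerSeries (PowerSeries ℚ)} {k : ℕ} {c : ℚ}
    (h : G - c • layer (plethExp 1) 0 ^ (k + 1) ∈ expFil k) : G ∈ expFil (k + 1) := by
  have := add_mem (expFil_mono k.le_succ h)
    ((expFil (k + 1)).smul_mem c (layer_pow_mem_expFil (k + 1)))
  rwa [sub_add_cancel] at this

lemma layer_Prhs_zero : layer Prhs 0 = layer (plethExp 1) 0 :=
  layer_congr fun n => by simp [Prhs, mul_assoc, Qfull_eq_plethExp]

lemma layer_Prhs_succ_sub_mem (k : ℕ) :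
    layer Prhs (k + 1) - (cSeq (k + 1) / (k + 2)) • layer (plethExp 1) 0 ^ (k + 2) ∈
      expFil (k + 1) := by
  set U := layer (plethExp 1) 0 with hU
  set T : ℕ → Qmt := fun n => if 2 ∣ n then tPow 2 (Qfull (n / 2)) else 0 with hT
  have hTmem : layer T k ∈ expFil 0 := layer_mem_expFil_zero (N := 0) fun n _ => by
    have : T n ∈ mDegLE (n / 2) := by
      simp only [hT]
      split_ifs
      · rw [Qfull_eq_plethExp]
        exact tPow_mem_mDegLE two_pos (plethExp_mem_mDegLE (one_mem_mDegLE 0) _)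
      · exact zero_mem _
    exact this k
  have hP : layer Prhs (k + 1) = layer (plethExp 1) (k + 1) -
      (2⁻¹ : ℚ) • ((∑ x ∈ antidiagonal k, layer truncExp x.1 * layer truncExp x.2) -
        layer T k) := by
    rw [← layer_mul truncExp_mem_mDegLE truncExp_mem_mDegLE, ← layer_sub]
    ext j n
    have (c : ℚ) (G : PowerSeries (PowerSeries ℚ)) :
      PowerSeries.coeff j (c • G) = c • PowerSeries.coeff j G := rfl
    rw [map_sub, map_sub, this, PowerSeries.coeff_smul, coeff_layer, coeff_layer, coeff_layer,
      Prhs, mul_assoc, coeff_sub, coeff_C_mul, coeff_X_mul, reflect_sub, reflect_C_mul, coeff_sub,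
      coeff_C_mul, sum_Icc_Qfull_mul, Qfull_eq_plethExp, smul_eq_mul]
  have hmul : ∑ x ∈ antidiagonal k, layer truncExp x.1 * layer truncExp x.2 -
      (∑ x ∈ antidiagonal k, cSeq x.1 * cSeq x.2) • U ^ (k + 2) ∈ expFil (k + 1) := by
    rw [Finset.sum_smul, ← Finset.sum_sub_distrib]
    refine sum_mem fun x hx => ?_
    rw [mem_antidiagonal] at hx
    have h2 := mul_mem_expFil (layer_truncExp_sub_mem x.1)
      (mem_expFil_succ_of_sub_mem (layer_truncExp_sub_mem x.2))
    have h3 := mul_mem_expFil ((expFil (x.1 + 1)).smul_mem (cSeq x.1)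
      (layer_pow_mem_expFil (x.1 + 1))) (layer_truncExp_sub_mem x.2)
    rw [show x.1 + (x.2 + 1) = k + 1 by omega] at h2
    rw [show x.1 + 1 + x.2 = k + 1 by omega] at h3
    convert add_mem h2 h3 using 1
    rw [sub_mul, mul_sub, smul_mul_smul_comm, ← pow_add,
      show x.1 + 1 + (x.2 + 1) = k + 2 by omega]
    abel
  have := add_mem (sub_mem (layer_plethExp_one_sub_mem (k + 1))
    (Submodule.smul_mem _ (2⁻¹ : ℚ) hmul))
    (Submodule.smul_mem _ (2⁻¹ : ℚ) (expFil_mono (Nat.zero_le (k + 1)) hTmem))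
  convert this using 1
  rw [hP, ← cSeq_succ_sub]
  module

lemma layer_sub_mem_of_mul_eq_Prhs {P : ℕ → Qmt}
    (hP : ∀ n : ℕ, 3 ≤ n → (1 + X) * P n = Prhs n) (k : ℕ) :
    layer P k - (cSeq k / (k + 1)) • layer (plethExp 1) 0 ^ (k + 1) ∈ expFil k := by
  induction k with
  | zero =>
    have h : layer P 0 - layer Prhs 0 ∈ expFil 0 :=
      layer_sub_mem_expFil_zero (N := 3) fun n hn => by simp [← hP n hn]
    simpa [layer_Prhs_zero, cSeq_zero] using h
  | succ k ih =>
    have h : layer P (k + 1) - layer (fun n => Prhs n - X * P n) (k + 1) ∈ expFil 0 :=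
      layer_sub_mem_expFil_zero (N := 3) fun n hn => by
        simp [← hP n hn, add_mul]
    have hX : layer (fun n => X * P n) (k + 1) = layer P k := layer_congr fun n => coeff_X_mul _ _
    rw [layer_sub, hX] at h
    have := sub_mem (add_mem (expFil_mono (Nat.zero_le _) h) (layer_Prhs_succ_sub_mem k))
      (mem_expFil_succ_of_sub_mem ih)
    convert this using 1
    rw [show ((k + 1 : ℕ) : ℚ) + 1 = k + 2 by push_cast; ring]
    abel

end LogConcavity

/-- Let `𝒫ₙ` (for `n ≥ 3`) be the unique polynomials satisfying
`(1+t)·𝒫ₙ = 𝒬ₙ − (t/2)(Σ_{h=2}^{n-2} 𝒬_h 𝒬_{n-h} − 𝒬_{n/2}^{[2]})`.  For fixed `j ≥ 1` and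
`k ≥ 0`, for all sufficiently large `n`,
`(𝒫_{n,k}^{n−j})² ≥ 𝒫_{n,k}^{n−j−1}·𝒫_{n,k}^{n−j+1}` and
`(𝒬_{n,k}^{n−j})² ≥ 𝒬_{n,k}^{n−j−1}·𝒬_{n,k}^{n−j+1}`. -/
theorem asymptotic_log_concavity_coeff_m (j k : ℕ) (hj : 1 ≤ j)
    (P : ℕ → Qmt) (hP : ∀ n : ℕ, 3 ≤ n → (1 + Polynomial.X) * P n = Prhs n) :
    ∃ N : ℕ, ∀ n : ℕ, N ≤ n →
      (((P n).coeff k).coeff (n - j)) ^ 2 ≥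
          (((P n).coeff k).coeff (n - j - 1)) * (((P n).coeff k).coeff (n - j + 1)) ∧
      ((Qnk n k).coeff (n - j)) ^ 2 ≥
          ((Qnk n k).coeff (n - j - 1)) * ((Qnk n k).coeff (n - j + 1)) := by
  obtain ⟨N, hN⟩ := Filter.eventually_atTop.1
    ((eventually_coeff_mul_le_sq (div_ne_zero (cSeq_pos k).ne' (by positivity))
      (layer_sub_mem_of_mul_eq_Prhs hP k) hj).and
        (eventually_coeff_mul_le_sq (cSeq_pos k).ne' (layer_plethExp_one_sub_mem k) hj))
  refine ⟨N, fun n hn => ⟨(hN n hn).1, ?_⟩⟩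
  rw [Qnk, Qfull_eq_plethExp]
  exact (hN n hn).2
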